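/- arXiv:2401.04356 — 2 statements merged into one kernel-verified Lean document; each statement's English description precedes it below -/
import Mathlib

section
/- Let a < n be coprime positive integers with n > 1 and continued fraction data as below, and set u_i = v_i + (1,0) for −1 ≤ i ≤ m (so u_{−1} = (1,1) and u_m = (a+1, n)). Let V be the finite set V = {u_{−1}} ∪ {u_i : i odd, 0 ≤ i < m} ∪ {u_m − v_i : i even, 0 ≤ i < m} ∪ {u_m − u_{−1}} ∪ {u_m − u_i : i odd, 0 ≤ i < m} ∪ {v_i : i even, 0 ≤ i < m}. Then the interior hull of P_{a,n} equals the convex hull of V, and V is exactly the set of extreme points of P_{a,n}^{(1)}. -/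
/-- The set of lattice points of `ℝ²`. -/
def latt : Set (ℝ × ℝ) := {p | ∃ z : ℤ × ℤ, p = ((z.1 : ℝ), (z.2 : ℝ))}

/-- The canonical embedding `ℤ² → ℝ²`. -/
def c (z : ℤ × ℤ) : ℝ × ℝ := ((z.1 : ℝ), (z.2 : ℝ))

/-- The clean lattice parallelogram with vertices `(0,0), (1,0), (a,n), (a+1,n)`. -/
noncomputable def Pan (a n : ℕ) : Set (ℝ × ℝ) :=
  convexHull ℝ ({(0, 0), (1, 0), ((a : ℝ), (n : ℝ)), ((a : ℝ) + 1, (n : ℝ))} : Set (ℝ × ℝ))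

open Set

/-- The height of `z` over the line through the origin and `(a, n)`. -/
def ht (a n : ℤ) (z : ℤ × ℤ) : ℤ := n * z.1 - a * z.2

/-- The lattice points in the interior of the parallelogram `P_{a,n}`. -/
def innerPts (a n : ℤ) : Set (ℤ × ℤ) :=
  {z | (0 < z.2 ∧ z.2 < n) ∧ 0 < ht a n z ∧ ht a n z < n}

/-- `v` is the sequence of convergents (shifted by two) of `n / a = [q 0, …, q m]`, where the last
partial quotient is at least two. -/
structure IsConvergents (a n : ℤ) (m : ℕ) (q : ℕ → ℕ) (v : ℕ → ℤ × ℤ) : Prop where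
  zero : v 0 = (1, 0)
  one : v 1 = (0, 1)
  fst_add_two : ∀ i ≤ m, (v (i + 2)).1 = (v i).1 + q i * (v (i + 1)).1
  snd_add_two : ∀ i ≤ m, (v (i + 2)).2 = (v i).2 + q i * (v (i + 1)).2
  one_le : ∀ i ≤ m, 1 ≤ q i
  two_le : 2 ≤ q m
  last : v (m + 2) = (a, n)

/-- The distance (up to scaling) of the `j`-th convergent to the line through `(a, n)`. -/
def absHt (a n : ℤ) (v : ℕ → ℤ × ℤ) (j : ℕ) : ℤ := (-1) ^ j * ht a n (v j)

lemma neg_one_pow_mul_self (j : ℕ) : ((-1 : ℤ) ^ j) * (-1) ^ j = 1 := by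
  rw [← mul_pow]; simp

namespace IsConvergents

variable {a n : ℤ} {m : ℕ} {q : ℕ → ℕ} {v : ℕ → ℤ × ℤ}

lemma det_eq (h : IsConvergents a n m q v) :
    ∀ j ≤ m + 1, (v j).1 * (v (j + 1)).2 - (v j).2 * (v (j + 1)).1 = (-1) ^ j := by
  intro j
  induction j with
  | zero => intro _; simp [h.zero, h.one]
  | succ k ih =>
    intro hk
    rw [show k + 1 + 1 = k + 2 from rfl, h.fst_add_two k (by omega), h.snd_add_two k (by omega),
      pow_succ, ← ih (by omega)]
    ring

lemma absHt_eq (h : IsConvergents a n m q v) {j : ℕ} (hj : j ≤ m) :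
    absHt a n v j = q j * absHt a n v (j + 1) + absHt a n v (j + 2) := by
  simp only [absHt, ht, h.fst_add_two j hj, h.snd_add_two j hj, pow_succ]
  ring

lemma absHt_last (h : IsConvergents a n m q v) : absHt a n v (m + 2) = 0 := by
  simp only [absHt, ht, h.last]; ring

lemma absHt_succ_last (h : IsConvergents a n m q v) : absHt a n v (m + 1) = 1 := by
  have h1 := h.det_eq (m + 1) le_rfl
  rw [show m + 1 + 1 = m + 2 from rfl, h.last] at h1
  simp only [absHt, ht]
  linear_combination (-1) ^ (m + 1) * h1 + neg_one_pow_mul_self (m + 1)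

lemma absHt_pos_and_lt (h : IsConvergents a n m q v) :
    ∀ k j, j + k = m → 0 < absHt a n v (j + 1) ∧ absHt a n v (j + 1) < absHt a n v j := by
  intro k
  induction k with
  | zero =>
    rintro j rfl
    have h2 : (2 : ℤ) ≤ q j := by exact_mod_cast h.two_le
    rw [h.absHt_eq (j := j) (by omega)]
    have h3 := h.absHt_last
    have h4 := h.absHt_succ_last
    simp only [Nat.add_zero] at h3 h4
    rw [h3, h4]
    omega
  | succ k ih =>
    intro j hj
    obtain ⟨h1, h2⟩ := ih (j + 1) (by omega)
    have h3 : (1 : ℤ) ≤ q j := by exact_mod_cast h.one_le j (by omega)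
    have h4 := h.absHt_eq (j := j) (by omega)
    rw [show j + 1 + 1 = j + 2 from rfl] at h1 h2
    constructor
    · omega
    · nlinarith

lemma absHt_pos (h : IsConvergents a n m q v) {j : ℕ} (hj : j ≤ m + 1) : 0 < absHt a n v j := by
  rcases j with _ | j
  · have := h.absHt_pos_and_lt m 0 (by omega); omega
  · exact (h.absHt_pos_and_lt (m - j) j (by omega)).1

lemma absHt_nonneg (h : IsConvergents a n m q v) {j : ℕ} (hj : j ≤ m + 2) : 0 ≤ absHt a n v j := by
  rcases hj.eq_or_lt with rfl | hj
  · exact h.absHt_last.ge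
  · exact (h.absHt_pos (by omega)).le

lemma absHt_succ_lt (h : IsConvergents a n m q v) {j : ℕ} (hj : j ≤ m) :
    absHt a n v (j + 1) < absHt a n v j :=
  (h.absHt_pos_and_lt (m - j) j (by omega)).2

lemma absHt_zero (h : IsConvergents a n m q v) : absHt a n v 0 = n := by
  simp [absHt, ht, h.zero]

lemma two_mul_absHt_lt (h : IsConvergents a n m q v) :
    ∀ j, j + 2 ≤ m + 1 → 2 * absHt a n v (j + 2) < n := by
  intro j
  induction j with
  | zero =>
    intro hj
    have h1 := h.absHt_eq (j := 0) (by omega)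
    have h2 := h.absHt_succ_lt (j := 1) (by omega)
    have h3 := h.absHt_pos (j := 1) (by omega)
    have h4 : (1 : ℤ) ≤ q 0 := by exact_mod_cast h.one_le 0 (by omega)
    rw [h.absHt_zero] at h1
    simp only [Nat.zero_add, Nat.reduceAdd] at *
    nlinarith
  | succ k ih =>
    intro hj
    have h1 := h.absHt_succ_lt (j := k + 2) (by omega)
    have h2 := ih (by omega)
    rw [show k + 1 + 2 = k + 2 + 1 by omega]
    omega

lemma snd_nonneg_and_pos (h : IsConvergents a n m q v) :
    ∀ j ≤ m + 1, 0 ≤ (v j).2 ∧ 0 < (v (j + 1)).2 := by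
  intro j
  induction j with
  | zero => intro _; simp [h.zero, h.one]
  | succ k ih =>
    intro hk
    obtain ⟨h1, h2⟩ := ih (by omega)
    refine ⟨h2.le, ?_⟩
    have h4 : (1 : ℤ) ≤ q k := by exact_mod_cast h.one_le k (by omega)
    rw [show k + 1 + 1 = k + 2 from rfl, h.snd_add_two k (by omega)]
    nlinarith

lemma snd_pos (h : IsConvergents a n m q v) {j : ℕ} (hj : j ≤ m + 1) : 0 < (v (j + 1)).2 :=
  (h.snd_nonneg_and_pos j hj).2

lemma exists_snd_le_lt (h : IsConvergents a n m q v) {y : ℤ} (hy : 0 < y) (hyn : y < n) :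
    ∃ j ≤ m, (v (j + 1)).2 ≤ y ∧ y < (v (j + 2)).2 := by
  by_contra! hcon
  have key : ∀ j ≤ m + 1, (v (j + 1)).2 ≤ y := by
    intro j
    induction j with
    | zero => intro _; simp [h.one]; omega
    | succ k ih => intro hk; exact hcon k (by omega) (ih (by omega))
  have := key (m + 1) le_rfl
  rw [show m + 1 + 1 = m + 2 from rfl, h.last] at this
  simp only at this
  omega

lemma ht_eq (a n : ℤ) (v : ℕ → ℤ × ℤ) (j : ℕ) : ht a n (v j) = (-1) ^ j * absHt a n v j := by
  rw [absHt, ← mul_assoc, neg_one_pow_mul_self, one_mul]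

lemma abs_ht (h : IsConvergents a n m q v) {j : ℕ} (hj : j ≤ m + 2) :
    |ht a n (v j)| = absHt a n v j := by
  rw [ht_eq, abs_mul, abs_pow, abs_neg, abs_one, one_pow, one_mul,
    abs_of_nonneg (h.absHt_nonneg hj)]

/-- The coordinates of a lattice point in the basis of two consecutive convergents. -/
lemma exists_coords (h : IsConvergents a n m q v) {j : ℕ} (hj : j ≤ m + 1) (w : ℤ × ℤ) :
    ∃ α β : ℤ, w.1 = α * (v j).1 + β * (v (j + 1)).1 ∧ w.2 = α * (v j).2 + β * (v (j + 1)).2 := by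
  have h1 := h.det_eq j hj
  have h2 := neg_one_pow_mul_self j
  refine ⟨(-1) ^ j * (w.1 * (v (j + 1)).2 - w.2 * (v (j + 1)).1),
    (-1) ^ j * ((v j).1 * w.2 - (v j).2 * w.1), ?_, ?_⟩
  · linear_combination (-w.1) * h2 - (-1) ^ j * w.1 * h1
  · linear_combination (-w.2) * h2 - (-1) ^ j * w.2 * h1

lemma abs_ht_of_coords (j : ℕ) (w : ℤ × ℤ) {α β : ℤ}
    (h1 : w.1 = α * (v j).1 + β * (v (j + 1)).1) (h2 : w.2 = α * (v j).2 + β * (v (j + 1)).2) :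
    |ht a n w| = |α * absHt a n v j - β * absHt a n v (j + 1)| := by
  have : ht a n w = (-1) ^ j * (α * absHt a n v j - β * absHt a n v (j + 1)) := by
    have e1 := ht_eq a n v j
    have e2 := ht_eq a n v (j + 1)
    rw [pow_succ] at e2
    simp only [ht] at e1 e2 ⊢
    rw [h1, h2]
    linear_combination α * e1 + β * e2
  rw [this, abs_mul, abs_pow, abs_neg, abs_one, one_pow, one_mul]

/-- Lattice points that are not convergents are beaten in both coordinates. -/
lemma eq_or_exists_smaller (h : IsConvergents a n m q v) {w : ℤ × ℤ} (hw : 0 < w.2)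
    (hwn : 2 * w.2 ≤ n) (hf : 2 * |ht a n w| ≤ n) :
    (∃ i < m, w = v (i + 2)) ∨ w.2 = 1 ∨
      ∃ d : ℤ × ℤ, 0 < d.2 ∧ d.2 < w.2 ∧ |ht a n d| < |ht a n w| := by
  obtain ⟨j, hj, hj1, hj2⟩ := h.exists_snd_le_lt hw (by omega)
  have hY := h.snd_pos (j := j) (by omega)
  have hY2 := h.snd_pos (j := j + 1) (by omega)
  rw [show j + 1 + 1 = j + 2 from rfl] at hY2
  rcases hj1.eq_or_lt with heq | hlt
  · rcases j with _ | j
    · right; left; rw [← heq]; simp [h.one]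
    · left
      refine ⟨j, by omega, ?_⟩
      rw [show j + 1 + 1 = j + 2 from rfl] at heq
      have h1 := h.two_mul_absHt_lt j (by omega)
      rw [← h.abs_ht (by omega)] at h1
      have h2 : ht a n w - ht a n (v (j + 2)) = n * (w.1 - (v (j + 2)).1) := by
        simp only [ht, heq]; ring
      have h3 : |n * (w.1 - (v (j + 2)).1)| < n := by
        rw [← h2]
        have := abs_sub (ht a n w) (ht a n (v (j + 2)))
        omega
      have hn : 0 < n := by omega
      rw [abs_mul, abs_of_pos hn] at h3
      have h4 : |w.1 - (v (j + 2)).1| < 1 := by nlinarith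
      rw [Int.abs_lt_one_iff] at h4
      exact Prod.ext (by omega) heq.symm
  · right; right
    refine ⟨v (j + 1), hY, hlt, ?_⟩
    obtain ⟨α, β, h1, h2⟩ := h.exists_coords (j := j + 1) (by omega) w
    rw [abs_ht_of_coords (j + 1) w h1 h2, h.abs_ht (by omega)]
    rw [show j + 1 + 1 = j + 2 from rfl] at h2 ⊢
    have hF := h.absHt_pos (j := j + 1) (by omega)
    have hF2 := h.absHt_nonneg (j := j + 2) (by omega)
    rcases lt_trichotomy β 0 with hβ | rfl | hβ
    · have hα : 2 ≤ α := by
        by_contra! hα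
        nlinarith
      refine lt_of_lt_of_le ?_ (le_abs_self _)
      nlinarith
    · have hα : 2 ≤ α := by
        by_contra! hα
        nlinarith
      refine lt_of_lt_of_le ?_ (le_abs_self _)
      nlinarith
    · have hα : α ≤ -1 := by
        by_contra! hα
        nlinarith
      refine lt_of_lt_of_le ?_ (neg_le_abs _)
      rcases hj.eq_or_lt with rfl | hj
      · rw [h.absHt_last]
        have hα : α ≤ -2 := by
          by_contra! hα'
          obtain rfl : α = -1 := by omega
          rw [h.last] at h2 hY2
          simp only at h2 hY2
          nlinarith
        nlinarith
      · have := h.absHt_pos (j := j + 2) (by omega)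
        nlinarith

/-- Each convergent is the unique minimum of some linear form on its half-quadrant. -/
lemma exists_linear_form (h : IsConvergents a n m q v) {i : ℕ} (hi : i < m) :
    ∃ A B : ℤ, ∀ w : ℤ × ℤ, 0 < w.2 → 0 < (-1) ^ i * ht a n w → w ≠ v (i + 2) →
      A * (v (i + 2)).1 + B * (v (i + 2)).2 < A * w.1 + B * w.2 := by
  have hd1 := h.det_eq (i + 1) (by omega)
  have hd2 := h.det_eq (i + 2) (by omega)
  have hx := h.fst_add_two (i + 1) (by omega)
  have hy := h.snd_add_two (i + 1) (by omega)
  have hs := neg_one_pow_mul_self (i + 1)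
  have hq : (1 : ℤ) ≤ q (i + 1) := by exact_mod_cast h.one_le (i + 1) (by omega)
  have hF1 := h.absHt_pos (j := i + 1) (by omega)
  have hF2 := h.absHt_pos (j := i + 2) (by omega)
  have hF3 := h.absHt_nonneg (j := i + 3) (by omega)
  have hF := h.absHt_eq (j := i + 1) (by omega)
  have hY1 := h.snd_pos (j := i) (by omega)
  have hY2 := h.snd_pos (j := i + 1) (by omega)
  have hY3 := h.snd_pos (j := i + 2) (by omega)
  simp only [add_assoc, Nat.reduceAdd] at *
  refine ⟨-((-1) ^ (i + 1) * ((v (i + 1)).2 + (v (i + 3)).2)),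
    (-1) ^ (i + 1) * ((v (i + 1)).1 + (v (i + 3)).1), fun w hw hht hne => ?_⟩
  obtain ⟨α, β, h1, h2⟩ := h.exists_coords (j := i + 1) (by omega) w
  simp only [add_assoc, Nat.reduceAdd] at h1 h2
  have hht' : (-1) ^ i * ht a n w = β * absHt a n v (i + 2) - α * absHt a n v (i + 1) := by
    simp only [absHt, ht, h1, h2, pow_succ]; ring
  rw [hht'] at hht
  have hβ : 1 ≤ β := by
    by_contra! hβ
    rcases le_or_gt α 0 with hα | hα <;> nlinarith
  have hγ : 1 ≤ β - α * q (i + 1) := by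
    have e1 : w.2 = (β - α * q (i + 1)) * (v (i + 2)).2 + α * (v (i + 3)).2 := by
      rw [h2, hy]; ring
    have e2 : β * absHt a n v (i + 2) - α * absHt a n v (i + 1) =
        (β - α * q (i + 1)) * absHt a n v (i + 2) - α * absHt a n v (i + 3) := by
      rw [hF]; ring
    rw [e2] at hht
    rw [e1] at hw
    by_contra! hγ
    rcases le_or_gt α 0 with hα | hα <;> nlinarith
  have hsum : 2 < β + (β - α * q (i + 1)) := by
    by_contra! hle
    obtain rfl : β = 1 := by omega
    have : α * q (i + 1) = 0 := by omega
    obtain rfl : α = 0 := by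
      rcases mul_eq_zero.1 this with h0 | h0 <;> omega
    exact hne (Prod.ext (by rw [h1]; ring) (by rw [h2]; ring))
  have e0 : -((-1) ^ (i + 1) * ((v (i + 1)).2 + (v (i + 3)).2)) * (v (i + 2)).1 +
      (-1) ^ (i + 1) * ((v (i + 1)).1 + (v (i + 3)).1) * (v (i + 2)).2 = 2 := by
    rw [hx, hy]
    linear_combination 2 * hs + 2 * (-1) ^ (i + 1) * hd1
  have e1 : -((-1) ^ (i + 1) * ((v (i + 1)).2 + (v (i + 3)).2)) * w.1 +
      (-1) ^ (i + 1) * ((v (i + 1)).1 + (v (i + 3)).1) * w.2 = β + (β - α * q (i + 1)) := by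
    rw [h1, h2, hx, hy]
    linear_combination (2 * β - α * q (i + 1)) * (hs + (-1) ^ (i + 1) * hd1)
  rw [e0, e1]
  exact hsum

end IsConvergents

lemma reflect_mem_innerPts {a n : ℤ} {z : ℤ × ℤ} (hz : z ∈ innerPts a n) :
    (a + 1, n) - z ∈ innerPts a n := by
  obtain ⟨⟨h1, h2⟩, h3, h4⟩ := hz
  have : ht a n ((a + 1, n) - z) = n - ht a n z := by simp [ht]; ring
  refine ⟨⟨?_, ?_⟩, ?_, ?_⟩
  · simpa using h2
  · simpa using h1
  · rw [this]; omega
  · rw [this]; omega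

/-- `z` is the unique minimum on `S` of some integral linear form. -/
def IsLinearMin (S : Set (ℤ × ℤ)) (z : ℤ × ℤ) : Prop :=
  ∃ A B : ℤ, ∀ w ∈ S, w ≠ z → A * z.1 + B * z.2 < A * w.1 + B * w.2

lemma IsLinearMin.reflect {a n : ℤ} {z : ℤ × ℤ} (hz : IsLinearMin (innerPts a n) z) :
    IsLinearMin (innerPts a n) ((a + 1, n) - z) := by
  obtain ⟨A, B, h⟩ := hz
  refine ⟨-A, -B, fun w hw hne => ?_⟩
  have := h _ (reflect_mem_innerPts hw) (fun e => hne (by rw [← e]; abel))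
  simp only [Prod.fst_sub, Prod.snd_sub] at this ⊢
  linarith

/-- `z` is the midpoint of two other points of `S`. -/
def IsMidpoint (S : Set (ℤ × ℤ)) (z : ℤ × ℤ) : Prop :=
  ∃ d : ℤ × ℤ, d ≠ 0 ∧ z + d ∈ S ∧ z - d ∈ S

lemma IsMidpoint.of_reflect {a n : ℤ} {z : ℤ × ℤ}
    (hz : IsMidpoint (innerPts a n) ((a + 1, n) - z)) : IsMidpoint (innerPts a n) z := by
  obtain ⟨d, hd, h1, h2⟩ := hz
  refine ⟨d, hd, ?_, ?_⟩
  · convert reflect_mem_innerPts h2 using 1; abel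
  · convert reflect_mem_innerPts h1 using 1; abel

lemma isMidpoint_of_small {a n : ℤ} {z d : ℤ × ℤ} (hd : 0 < d.2) (h1 : d.2 < z.2)
    (h2 : 2 * z.2 ≤ n) (h3 : |ht a n d| < ht a n z) (h4 : |ht a n d| < n - ht a n z) :
    IsMidpoint (innerPts a n) z := by
  obtain ⟨h5, h6⟩ := abs_lt.1 h3
  obtain ⟨h7, h8⟩ := abs_lt.1 h4
  have e1 : ht a n (z + d) = ht a n z + ht a n d := by simp [ht]; ring
  have e2 : ht a n (z - d) = ht a n z - ht a n d := by simp [ht]; ring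
  refine ⟨d, fun h => by simp [h] at hd, ⟨⟨?_, ?_⟩, ?_, ?_⟩, ⟨⟨?_, ?_⟩, ?_, ?_⟩⟩ <;>
    simp only [e1, e2, Prod.snd_add, Prod.snd_sub] <;> omega

/-- The half of the vertex set lying in the lower half of the parallelogram. -/
def lowerVerts (m : ℕ) (v : ℕ → ℤ × ℤ) : Set (ℤ × ℤ) :=
  {z | z = (1, 1) ∨ (∃ i, Odd i ∧ i < m ∧ z = v (i + 2) + (1, 0)) ∨
    ∃ i, Even i ∧ i < m ∧ z = v (i + 2)}

namespace IsConvergents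

variable {a n : ℤ} {m : ℕ} {q : ℕ → ℕ} {v : ℕ → ℤ × ℤ}

lemma mem_lowerVerts_or_isMidpoint_of_le (h : IsConvergents a n m q v) (ha : 0 < a) (han : a < n)
    {z : ℤ × ℤ} (hz : z ∈ innerPts a n) (hle : 2 * z.2 ≤ n) :
    z ∈ lowerVerts m v ∨ IsMidpoint (innerPts a n) z := by
  obtain ⟨⟨h1, h2⟩, h3, h4⟩ := hz
  have hone : z.2 = 1 → z ∈ lowerVerts m v := by
    intro hz1
    left
    simp only [ht, hz1] at h3 h4
    have : 0 < z.1 := by nlinarith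
    have : z.1 < 2 := by nlinarith
    exact Prod.ext (by simp only; omega) hz1
  rcases le_or_gt (2 * ht a n z) n with hlow | hhigh
  · rcases h.eq_or_exists_smaller h1 hle (by rwa [abs_of_pos h3]) with
      ⟨i, hi, rfl⟩ | hz1 | ⟨d, hd, hd1, hd2⟩
    · left; right; right
      refine ⟨i, ?_, hi, rfl⟩
      by_contra hodd
      rw [ht_eq, pow_add, (Nat.not_even_iff_odd.1 hodd).neg_one_pow] at h3
      have := h.absHt_pos (j := i + 2) (by omega)
      omega
    · exact .inl (hone hz1)
    · rw [abs_of_pos h3] at hd2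
      exact .inr (isMidpoint_of_small hd hd1 hle hd2 (by omega))
  · have e : ht a n (z - (1, 0)) = ht a n z - n := by simp [ht]; ring
    have eabs : |ht a n (z - (1, 0))| = n - ht a n z := by
      rw [e, abs_of_neg (by omega)]; omega
    rcases h.eq_or_exists_smaller (w := z - (1, 0)) (by simpa using h1) (by simpa using hle)
      (by rw [eabs]; omega) with ⟨i, hi, hzi⟩ | hz1 | ⟨d, hd, hd1, hd2⟩
    · left; right; left
      refine ⟨i, ?_, hi, by rw [← hzi]; abel⟩
      by_contra heven
      rw [hzi, ht_eq, pow_add, (Nat.not_odd_iff_even.1 heven).neg_one_pow] at e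
      have := h.absHt_pos (j := i + 2) (by omega)
      omega
    · exact .inl (hone (by simpa using hz1))
    · rw [eabs] at hd2
      exact .inr (isMidpoint_of_small hd (by simpa using hd1) hle (by omega) hd2)

lemma mem_lowerVerts_or_isMidpoint (h : IsConvergents a n m q v) (ha : 0 < a) (han : a < n)
    {z : ℤ × ℤ} (hz : z ∈ innerPts a n) :
    z ∈ lowerVerts m v ∨ (a + 1, n) - z ∈ lowerVerts m v ∨ IsMidpoint (innerPts a n) z := by
  rcases le_or_gt (2 * z.2) n with hle | hlt
  · rcases h.mem_lowerVerts_or_isMidpoint_of_le ha han hz hle with h1 | h1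
    · exact .inl h1
    · exact .inr (.inr h1)
  · rcases h.mem_lowerVerts_or_isMidpoint_of_le ha han (reflect_mem_innerPts hz)
      (by simp only [Prod.snd_sub]; omega) with h1 | h1
    · exact .inr (.inl h1)
    · exact .inr (.inr h1.of_reflect)

lemma snd_lt_of_lt (h : IsConvergents a n m q v) :
    ∀ k i, i + k + 1 = m → (v (i + 2)).2 < n := by
  have step : ∀ i ≤ m, 1 ≤ i → (v (i + 1)).2 < (v (i + 2)).2 := by
    intro i hi hi1
    obtain ⟨j, rfl⟩ : ∃ j, i = j + 1 := ⟨i - 1, by omega⟩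
    have h1 := h.snd_pos (j := j) (by omega)
    have h2 := h.snd_pos (j := j + 1) (by omega)
    have h3 : (1 : ℤ) ≤ q (j + 1) := by exact_mod_cast h.one_le (j + 1) hi
    rw [h.snd_add_two (j + 1) hi]
    nlinarith
  intro k
  induction k with
  | zero =>
    rintro i rfl
    have := step (i + 1) le_rfl (by omega)
    have hl := h.last
    simp only [add_assoc, Nat.reduceAdd, zero_add] at *
    rw [hl] at this
    exact this
  | succ k ih =>
    intro i hi
    have h1 := ih (i + 1) (by omega)
    have h2 := step (i + 1) (by omega) (by omega)
    simp only [add_assoc, Nat.reduceAdd] at *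
    omega

lemma lowerVerts_subset (h : IsConvergents a n m q v) (ha : 0 < a) (han : a < n) :
    lowerVerts m v ⊆ innerPts a n := by
  have key : ∀ i < m, (0 < (v (i + 2)).2 ∧ (v (i + 2)).2 < n) ∧
      0 < absHt a n v (i + 2) ∧ absHt a n v (i + 2) < n := by
    intro i hi
    have h1 := h.snd_pos (j := i + 1) (by omega)
    have h2 := h.absHt_pos (j := i + 2) (by omega)
    have h3 := h.two_mul_absHt_lt i (by omega)
    exact ⟨⟨h1, h.snd_lt_of_lt (m - i - 1) i (by omega)⟩, h2, by omega⟩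
  rintro z (rfl | ⟨i, hodd, hi, rfl⟩ | ⟨i, heven, hi, rfl⟩)
  · refine ⟨⟨?_, ?_⟩, ?_, ?_⟩ <;> simp [ht] <;> omega
  · obtain ⟨h1, h2, h3⟩ := key i hi
    have e : ht a n (v (i + 2) + (1, 0)) = n - absHt a n v (i + 2) := by
      have e1 := ht_eq a n v (i + 2)
      rw [pow_add, hodd.neg_one_pow] at e1
      simp only [ht, Prod.fst_add, Prod.snd_add] at e1 ⊢
      linear_combination e1
    refine ⟨by simpa using h1, ?_⟩
    rw [e]; omega
  · obtain ⟨h1, h2⟩ := key i hi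
    refine ⟨h1, ?_⟩
    rw [ht_eq, pow_add, heven.neg_one_pow]
    simpa using h2

lemma isLinearMin_of_mem_lowerVerts (h : IsConvergents a n m q v) (ha : 0 < a) (han : a < n)
    {z : ℤ × ℤ} (hz : z ∈ lowerVerts m v) : IsLinearMin (innerPts a n) z := by
  rcases hz with rfl | ⟨i, hodd, hi, rfl⟩ | ⟨i, heven, hi, rfl⟩
  · refine ⟨0, 1, fun w hw hne => ?_⟩
    obtain ⟨⟨h1, h2⟩, h3, h4⟩ := hw
    have : w.2 ≠ 1 := by
      intro hw1
      simp only [ht, hw1] at h3 h4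
      have : 0 < w.1 := by nlinarith
      have : w.1 < 2 := by nlinarith
      exact hne (Prod.ext (by simp only; omega) hw1)
    simp only
    omega
  · obtain ⟨A, B, hAB⟩ := h.exists_linear_form hi
    refine ⟨A, B, fun w hw hne => ?_⟩
    obtain ⟨⟨h1, h2⟩, h3, h4⟩ := hw
    have e : ht a n (w - (1, 0)) = ht a n w - n := by simp [ht]; ring
    have := hAB (w - (1, 0)) (by simpa using h1) (by rw [hodd.neg_one_pow, e]; omega)
      (fun e => hne (by rw [← e]; abel))
    simp only [Prod.fst_sub, Prod.snd_sub, Prod.fst_add, Prod.snd_add] at this ⊢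
    linarith
  · obtain ⟨A, B, hAB⟩ := h.exists_linear_form hi
    exact ⟨A, B, fun w hw hne =>
      hAB w hw.1.1 (by rw [heven.neg_one_pow, one_mul]; exact hw.2.1) hne⟩

end IsConvergents

lemma mem_extremePoints_convexHull_of_lt {E : Type*} [AddCommGroup E] [Module ℝ E] {S : Set E}
    {p : E} (hp : p ∈ S) (g : E →ₗ[ℝ] ℝ) (hg : ∀ x ∈ S, x ≠ p → g p < g x) :
    p ∈ extremePoints ℝ (convexHull ℝ S) := by
  have hsub : convexHull ℝ S ⊆ {x | x = p ∨ g p < g x} := by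
    refine convexHull_min (fun x hx => ?_) ?_
    · by_cases hxp : x = p
      · exact .inl hxp
      · exact .inr (hg x hx hxp)
    · rw [convex_iff_forall_pos]
      rintro x (rfl | hx) y (rfl | hy) s t hs ht hst
      · left; rw [← add_smul, hst, one_smul]
      · right
        simp only [map_add, map_smul, smul_eq_mul]
        obtain rfl : s = 1 - t := by linarith
        nlinarith
      · right
        simp only [map_add, map_smul, smul_eq_mul]
        obtain rfl : s = 1 - t := by linarith
        nlinarith
      · right
        simp only [map_add, map_smul, smul_eq_mul]
        obtain rfl : s = 1 - t := by linarith
        nlinarith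
  rw [mem_extremePoints_iff_left]
  refine ⟨subset_convexHull ℝ S hp, ?_⟩
  rintro x hx y hy ⟨s, t, hs, ht, hst, rfl⟩
  by_contra hne
  have h1 := (hsub hx).resolve_left hne
  have h2 : g (s • x + t • y) ≤ g y := by
    rcases hsub hy with h | h
    · exact le_of_eq (by rw [← h])
    · exact h.le
  simp only [map_add, map_smul, smul_eq_mul] at h1 h2
  obtain rfl : s = 1 - t := by linarith
  nlinarith

/-- If the points of a finite set `I` that are not midpoints are unique minima of linear forms, then
they are the extreme points of the convex hull. -/
lemma convexHull_and_extremePoints_of_linearMin {I V : Set (ℤ × ℤ)} (hI : I.Finite) (hVI : V ⊆ I)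
    (hmin : ∀ z ∈ V, IsLinearMin I z) (hmid : ∀ z ∈ I, z ∈ V ∨ IsMidpoint I z) :
    convexHull ℝ (c '' I) = convexHull ℝ (c '' V) ∧
      extremePoints ℝ (convexHull ℝ (c '' I)) = c '' V := by
  have hext : extremePoints ℝ (convexHull ℝ (c '' I)) = c '' V := by
    apply Subset.antisymm
    · intro p hp
      obtain ⟨z, hz, rfl⟩ := extremePoints_convexHull_subset hp
      rcases hmid z hz with hV | ⟨d, hd, h1, h2⟩
      · exact mem_image_of_mem c hV
      · exfalso
        have := (mem_extremePoints_iff_left.1 hp).2 _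
          (subset_convexHull ℝ _ (mem_image_of_mem c h1)) _
          (subset_convexHull ℝ _ (mem_image_of_mem c h2))
          ⟨1 / 2, 1 / 2, by norm_num, by norm_num, by norm_num, by
            ext <;> simp [c] <;> ring⟩
        apply hd
        simpa [c, Prod.ext_iff] using this
    · rintro _ ⟨z, hz, rfl⟩
      obtain ⟨A, B, hAB⟩ := hmin z hz
      refine mem_extremePoints_convexHull_of_lt (mem_image_of_mem c (hVI hz))
        ((A : ℝ) • LinearMap.fst ℝ ℝ ℝ + (B : ℝ) • LinearMap.snd ℝ ℝ ℝ) ?_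
      rintro _ ⟨w, hw, rfl⟩ hne
      have := hAB w hw (fun e => hne (by rw [e]))
      simp only [c, LinearMap.add_apply, LinearMap.smul_apply, LinearMap.fst_apply,
        LinearMap.snd_apply, smul_eq_mul]
      exact_mod_cast this
  refine ⟨?_, hext⟩
  have hcpt := (hI.image c).isCompact_convexHull ℝ
  have hKM := closure_convexHull_extremePoints hcpt (convex_convexHull ℝ _)
  rw [hext] at hKM
  rw [← hKM]
  exact (((hI.subset hVI).image c).isClosed_convexHull ℝ).closure_eq

/-- The linear change of coordinates taking the parallelogram `P_{a,n}` to a square. -/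
noncomputable def squareHomeomorph (a n : ℝ) (hn : n ≠ 0) : ℝ × ℝ ≃ₜ ℝ × ℝ where
  toFun p := (p.2, n * p.1 - a * p.2)
  invFun p := ((p.2 + a * p.1) / n, p.1)
  left_inv p := by ext <;> simp; field_simp
  right_inv p := by ext <;> simp; field_simp; ring
  continuous_toFun := by fun_prop
  continuous_invFun := by fun_prop

lemma Pan_eq_preimage {a n : ℕ} (hn : (n : ℝ) ≠ 0) :
    Pan a n = squareHomeomorph a n hn ⁻¹' (Icc 0 (n : ℝ) ×ˢ Icc 0 (n : ℝ)) := by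
  have hn0 : (0 : ℝ) ≤ n := Nat.cast_nonneg n
  have hpos : (0 : ℝ) < n := lt_of_le_of_ne hn0 hn.symm
  apply Subset.antisymm
  · refine convexHull_min ?_ ?_
    · rintro p (rfl | rfl | rfl | rfl) <;>
        simp [squareHomeomorph, mul_comm, mul_add]
    · rintro x ⟨⟨hx1, hx2⟩, hx3, hx4⟩ y ⟨⟨hy1, hy2⟩, hy3, hy4⟩ s t hs ht hst
      obtain rfl : s = 1 - t := by linarith
      simp only [squareHomeomorph, Homeomorph.homeomorph_mk_coe, Equiv.coe_fn_mk] at *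
      refine ⟨⟨?_, ?_⟩, ?_, ?_⟩ <;> simp <;> nlinarith
  · rintro ⟨x, y⟩ ⟨⟨h1, h2⟩, h3, h4⟩
    simp only [squareHomeomorph, Homeomorph.homeomorph_mk_coe, Equiv.coe_fn_mk] at h1 h2 h3 h4
    have hconv : Convex ℝ (Pan a n) := convex_convexHull ℝ _
    have hsub := subset_convexHull ℝ
      ({(0, 0), (1, 0), ((a : ℝ), (n : ℝ)), ((a : ℝ) + 1, (n : ℝ))} : Set (ℝ × ℝ))
    have ht0 : 0 ≤ (n * x - a * y) / n := by positivity
    have ht1 : (n * x - a * y) / n ≤ 1 := by rw [div_le_one hpos]; exact h4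
    have hs0 : 0 ≤ y / n := by positivity
    have hs1 : y / n ≤ 1 := by rw [div_le_one hpos]; exact h2
    have hb := hconv (hsub (by simp)) (hsub (by simp : ((1, 0) : ℝ × ℝ) ∈ _))
      (sub_nonneg.2 ht1) ht0 (by ring) (x := (0, 0))
    have ht := hconv (hsub (by simp)) (hsub (by simp : ((a + 1, n) : ℝ × ℝ) ∈ _))
      (sub_nonneg.2 ht1) ht0 (by ring) (x := (a, n))
    have := hconv hb ht (sub_nonneg.2 hs1) hs0 (by ring)
    convert this using 1
    ext
    · simp; field_simp; ring
    · simp; field_simp; ring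

lemma interior_Pan_inter_latt {a n : ℕ} (hn : (n : ℝ) ≠ 0) :
    interior (Pan a n) ∩ latt = c '' innerPts a n := by
  rw [Pan_eq_preimage hn, ← Homeomorph.preimage_interior, interior_prod_eq, interior_Icc]
  have key : ∀ z : ℤ × ℤ, c z ∈ squareHomeomorph a n hn ⁻¹' (Ioo 0 (n : ℝ) ×ˢ Ioo 0 (n : ℝ)) ↔
      z ∈ innerPts a n := by
    intro z
    simp only [squareHomeomorph, c, innerPts, ht, mem_preimage, mem_prod, mem_Ioo,
      Homeomorph.homeomorph_mk_coe, Equiv.coe_fn_mk, mem_ofPred_eq]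
    norm_cast
  ext p
  constructor
  · rintro ⟨hp, z, rfl⟩
    exact ⟨z, (key z).1 hp, rfl⟩
  · rintro ⟨z, hz, rfl⟩
    exact ⟨(key z).2 hz, z, rfl⟩

lemma finite_innerPts {a n : ℤ} (ha : 0 < a) (han : a < n) : (innerPts a n).Finite := by
  refine (finite_Icc ((0, 0) : ℤ × ℤ) (a + 1, n)).subset ?_
  rintro z ⟨⟨h1, h2⟩, h3, h4⟩
  simp only [ht] at h3 h4
  refine ⟨⟨?_, h1.le⟩, ?_, h2.le⟩
  · simp only; nlinarith
  · simp only; nlinarith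


/-- Main theorem: with `uᵢ = vᵢ + (1,0)` (index shift by `2`: `v (i+2)` is the paper's
convergent `vᵢ`, `u₋₁ = (1,1)`, `u_m = (a+1,n)`), the set
`V = {u₋₁} ∪ {uᵢ : i odd, 0 ≤ i < m} ∪ {u_m - vᵢ : i even, 0 ≤ i < m} ∪ {u_m - u₋₁} ∪
{u_m - uᵢ : i odd, 0 ≤ i < m} ∪ {vᵢ : i even, 0 ≤ i < m}` satisfies: the interior hull of
`P_{a,n}` is the convex hull of `V`, and `V` is exactly its set of extreme points. -/
theorem stmt_15 (a n : ℕ) (ha : 0 < a) (han : a < n) (hn : 1 < n)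
    (hco : Nat.Coprime a n)
    (m : ℕ) (q : ℕ → ℕ) (v : ℕ → ℤ × ℤ)
    (hv0 : v 0 = (1, 0)) (hv1 : v 1 = (0, 1))
    (hrec : ∀ i ≤ m, v (i + 2) = v i + (q i : ℤ) • v (i + 1))
    (hq : ∀ i ≤ m, 1 ≤ q i) (hqm : 1 ≤ m → 2 ≤ q m)
    (hvm : v (m + 2) = ((a : ℤ), (n : ℤ)))
    (V : Set (ℤ × ℤ))
    (hV : V = {((1 : ℤ), (1 : ℤ))} ∪
        ((fun i => v (i + 2) + (1, 0)) '' {i | Odd i ∧ i < m}) ∪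
        ((fun i => ((a : ℤ) + 1, (n : ℤ)) - v (i + 2)) '' {i | Even i ∧ i < m}) ∪
        {(((a : ℤ) + 1, (n : ℤ)) - (1, 1) : ℤ × ℤ)} ∪
        ((fun i => ((a : ℤ) + 1, (n : ℤ)) - (v (i + 2) + (1, 0))) '' {i | Odd i ∧ i < m}) ∪
        ((fun i => v (i + 2)) '' {i | Even i ∧ i < m})) :
    convexHull ℝ (interior (Pan a n) ∩ latt) = convexHull ℝ (c '' V) ∧
    Set.extremePoints ℝ (convexHull ℝ (interior (Pan a n) ∩ latt)) = c '' V := by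
  have hn0 : (n : ℝ) ≠ 0 := by positivity
  have ha' : (0 : ℤ) < a := by exact_mod_cast ha
  have han' : (a : ℤ) < n := by exact_mod_cast han
  have hconv : IsConvergents a n m q v :=
    { zero := hv0
      one := hv1
      fst_add_two := fun i hi => by rw [hrec i hi]; simp
      snd_add_two := fun i hi => by rw [hrec i hi]; simp
      one_le := hq
      two_le := by
        rcases Nat.eq_zero_or_pos m with rfl | hm
        · rw [hrec 0 le_rfl, hv0, hv1] at hvm
          simp only [Prod.ext_iff] at hvm
          simp at hvm
          omega
        · exact hqm hm
      last := hvm }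
  have hmem : ∀ z, z ∈ V ↔ z ∈ lowerVerts m v ∨ ((a : ℤ) + 1, (n : ℤ)) - z ∈ lowerVerts m v := by
    intro z
    have hperm : ∀ A B C D E F : Prop,
        (((((A ∨ B) ∨ C) ∨ D) ∨ E) ∨ F) ↔ (A ∨ B ∨ F) ∨ D ∨ E ∨ C := by
      intros; tauto
    have hswap : ∀ x : ℤ × ℤ, ((a : ℤ) + 1, (n : ℤ)) - x = z ↔ ((a : ℤ) + 1, (n : ℤ)) - z = x :=
      fun x => ⟨fun h => by rw [← h]; abel, fun h => by rw [← h]; abel⟩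
    simp only [hV, lowerVerts, mem_union, mem_image, mem_ofPred_eq, mem_singleton_iff, hswap,
      eq_comm (a := z), and_assoc]
    exact hperm _ _ _ _ _ _
  rw [interior_Pan_inter_latt hn0]
  refine convexHull_and_extremePoints_of_linearMin (finite_innerPts ha' han') ?_ ?_ ?_
  · intro z hz
    rcases (hmem z).1 hz with h | h
    · exact hconv.lowerVerts_subset ha' han' h
    · simpa using reflect_mem_innerPts (hconv.lowerVerts_subset ha' han' h)
  · intro z hz
    rcases (hmem z).1 hz with h | h
    · exact hconv.isLinearMin_of_mem_lowerVerts ha' han' h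
    · simpa using (hconv.isLinearMin_of_mem_lowerVerts ha' han' h).reflect
  · intro z hz
    rw [hmem, or_assoc]
    exact hconv.mem_lowerVerts_or_isMidpoint ha' han' hz
end

section
/- Let a < n be coprime positive integers and let [q₀, q₁, …, q_m] be the continued fraction expansion of n/a produced by the Euclidean algorithm. Then the area of the interior hull satisfies area(P_{a,n}^{(1)}) = n − (q₀ + q₁ + ⋯ + q_m); equivalently, the sum of the partial quotients of n/a equals area(P_{a,n}) − area(P_{a,n}^{(1)}). Moreover, if in addition 1 < a < n−1, then the number of lattice points on the boundary of P_{a,n}^{(1)} equals 2(q₀ + q₁ + ⋯ + q_m) − 4. -/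
/-- The lattice points on the boundary of the convex hull of the lattice points of the box
`[1, a] × [0, n - 1]` lying strictly to the right of the segment from `(0, 0)` to `(a, n)`,
listed from `(1, 0)` to `(a, n - 1)`. -/
structure IsSail (a n : ℤ) (k : ℕ) (x y : ℕ → ℤ) : Prop where
  x_zero : x 0 = 1
  y_zero : y 0 = 0
  x_last : x k = a
  y_last : y k = n - 1
  box : ∀ i ≤ k, 1 ≤ x i ∧ x i ≤ a ∧ 0 ≤ y i ∧ y i ≤ n - 1 ∧ a * y i < n * x i
  edge : ∀ i < k, 0 ≤ x (i + 1) - x i ∧ 0 ≤ y (i + 1) - y i ∧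
    IsCoprime (x (i + 1) - x i) (y (i + 1) - y i)
  right : ∀ i < k, ∀ X Y : ℤ, 1 ≤ X → X ≤ a → 0 ≤ Y → Y ≤ n - 1 → a * Y < n * X →
    (Y - y i) * (x (i + 1) - x i) ≤ (X - x i) * (y (i + 1) - y i)
  area : ∑ i ∈ Finset.range k, (x i * y (i + 1) - x (i + 1) * y i) = k + 1 - a

/-- There is a sail with `k` edges. -/
def HasSail (a n : ℤ) (k : ℕ) : Prop := ∃ x y, IsSail a n k x y

theorem hasSail_one_one : HasSail 1 1 0 :=
  ⟨fun _ => 1, fun _ => 0, by constructor <;> simp⟩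

theorem HasSail.add_right {a n : ℤ} {k : ℕ} (ha : 0 < a) (hn : 0 < n) (h : HasSail a n k) :
    HasSail a (n + a) (k + 1) := by
  obtain ⟨x, y, h⟩ := h
  refine ⟨fun i => i.casesOn 1 x, fun i => i.casesOn 0 fun j => y j + x j, rfl, rfl, h.x_last,
    ?_, ?_, ?_, ?_, ?_⟩
  · change y k + x k = _
    rw [h.x_last, h.y_last]; ring
  · rintro (_ | i) hi
    · refine ⟨le_rfl, ?_, le_rfl, ?_, ?_⟩ <;> simp <;> lia
    · obtain ⟨h1, h2, h3, h4, h5⟩ := h.box i (by lia)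
      refine ⟨h1, h2, ?_, ?_, ?_⟩ <;> dsimp only <;> nlinarith
  · rintro (_ | i) hi
    · simp [h.x_zero, h.y_zero, isCoprime_one_right]
    · obtain ⟨h1, h2, h3⟩ := h.edge i (by lia)
      refine ⟨h1, ?_, ?_⟩
      · dsimp only; linarith
      · dsimp only
        have e : y (i + 1) + x (i + 1) - (y i + x i) =
            y (i + 1) - y i + (x (i + 1) - x i) * 1 := by ring
        rw [e]
        exact h3.add_mul_left_right 1
  · rintro (_ | i) hi X Y hX hXa hY hYn hd
    · simp [h.x_zero, h.y_zero]; lia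
    · obtain ⟨h1, h2, -⟩ := h.edge i (by lia)
      dsimp only
      rcases le_or_gt X Y with hXY | hXY
      · have := h.right i (by lia) X (Y - X) hX hXa (by lia) (by nlinarith) (by nlinarith)
        nlinarith
      · have := h.right i (by lia) X 0 hX hXa le_rfl (by lia) (by nlinarith)
        nlinarith
  · rw [Finset.sum_range_succ']
    have := h.area
    simp only [h.x_zero, h.y_zero]
    have e : ∀ i, x i * (y (i + 1) + x (i + 1)) - x (i + 1) * (y i + x i) =
      x i * y (i + 1) - x (i + 1) * y i := fun i => by ring
    simp only [e, this]
    push_cast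
    change (k : ℤ) + 1 - a + (1 * 1 - 1 * 0) = _
    ring

theorem HasSail.add_left {a n : ℤ} {k : ℕ} (ha : 0 < a) (hn : 0 < n) (h : HasSail a n k) :
    HasSail (a + n) n (k + 1) := by
  obtain ⟨x, y, h⟩ := h
  let x' : ℕ → ℤ := fun i => if i ≤ k then x i + y i else a + n
  let y' : ℕ → ℤ := fun i => if i ≤ k then y i else n - 1
  have hx : ∀ i ≤ k, x' i = x i + y i := fun i hi => if_pos hi
  have hy : ∀ i ≤ k, y' i = y i := fun i hi => if_pos hi
  have hx' : x' (k + 1) = a + n := if_neg (by lia)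
  have hy' : y' (k + 1) = n - 1 := if_neg (by lia)
  refine ⟨x', y', ?_, ?_, hx', hy', ?_, ?_, ?_, ?_⟩
  · simp [hx 0, h.x_zero, h.y_zero]
  · simp [hy 0, h.y_zero]
  · intro i hi
    rcases Nat.lt_or_eq_of_le hi with hi | rfl
    · obtain ⟨h1, h2, h3, h4, h5⟩ := h.box i (by lia)
      rw [hx i (by lia), hy i (by lia)]
      refine ⟨?_, ?_, ?_, ?_, ?_⟩ <;> nlinarith
    · rw [hx', hy']
      refine ⟨?_, ?_, ?_, ?_, ?_⟩ <;> nlinarith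
  · intro i hi
    rcases Nat.lt_or_eq_of_le (Nat.le_of_lt_succ hi) with hi | rfl
    · obtain ⟨h1, h2, h3⟩ := h.edge i hi
      rw [hx i (by lia), hy i (by lia), hx (i + 1) (by lia), hy (i + 1) (by lia)]
      refine ⟨by linarith, h2, ?_⟩
      have e : x (i + 1) + y (i + 1) - (x i + y i) =
          x (i + 1) - x i + (y (i + 1) - y i) * 1 := by ring
      rw [e]
      exact h3.add_mul_left_left 1
    · rw [hx', hy', hx i le_rfl, hy i le_rfl, h.x_last, h.y_last]
      refine ⟨by lia, by lia, ?_⟩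
      rw [show a + n - (a + (n - 1)) = 1 by ring]
      exact isCoprime_one_left
  · intro i hi X Y hX hXa hY hYn hd
    rcases Nat.lt_or_eq_of_le (Nat.le_of_lt_succ hi) with hi | rfl
    · obtain ⟨h1, h2, -⟩ := h.edge i hi
      rw [hx i (by lia), hy i (by lia), hx (i + 1) (by lia), hy (i + 1) (by lia)]
      rcases le_or_gt (X - Y) a with hXY | hXY
      · have := h.right i hi (X - Y) Y (by nlinarith) hXY hY hYn (by nlinarith)
        nlinarith
      · have := h.right i hi a Y ha le_rfl hY hYn (by nlinarith)
        nlinarith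
    · rw [hx', hy', hx i le_rfl, hy i le_rfl, h.x_last, h.y_last]
      nlinarith
  · rw [Finset.sum_range_succ, hx', hy', hx k le_rfl, hy k le_rfl, h.x_last, h.y_last]
    have e : ∀ i ∈ Finset.range k, x' i * y' (i + 1) - x' (i + 1) * y' i =
        x i * y (i + 1) - x (i + 1) * y i := fun i hi => by
      have := Finset.mem_range.1 hi
      rw [hx i (by lia), hy i (by lia), hx (i + 1) (by lia), hy (i + 1) (by lia)]
      ring
    rw [Finset.sum_congr rfl e, h.area]
    push_cast; ring

theorem HasSail.add_mul_right {a n : ℤ} {k : ℕ} (ha : 0 < a) (hn : 0 < n) (h : HasSail a n k)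
    (q : ℕ) : HasSail a (n + q * a) (k + q) := by
  induction q with
  | zero => simpa using h
  | succ q ih =>
    rw [← add_assoc, show n + ((q + 1 : ℕ) : ℤ) * a = n + q * a + a by push_cast; ring]
    exact ih.add_right ha (by positivity)

theorem HasSail.add_mul_left {a n : ℤ} {k : ℕ} (ha : 0 < a) (hn : 0 < n) (h : HasSail a n k)
    (q : ℕ) : HasSail (a + q * n) n (k + q) := by
  induction q with
  | zero => simpa using h
  | succ q ih =>
    rw [← add_assoc, show a + ((q + 1 : ℕ) : ℤ) * n = a + q * n + n by push_cast; ring]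
    exact ih.add_left (by positivity) hn

theorem hasSail_of_continuant (m : ℕ) (q : ℕ → ℕ) (v : ℕ → ℤ × ℤ)
    (hv0 : v 0 = (1, 0)) (hv1 : v 1 = (0, 1))
    (hrec : ∀ i ≤ m, v (i + 2) = v i + (q i : ℤ) • v (i + 1))
    (hq : ∀ i ≤ m, 1 ≤ q i) :
    0 < (v (m + 2)).1 ∧ 0 < (v (m + 2)).2 ∧
      ∃ k : ℕ, ∑ i ∈ Finset.range (m + 1), q i = k + 1 ∧
        HasSail (v (m + 2)).1 (v (m + 2)).2 k ∧ HasSail (v (m + 2)).2 (v (m + 2)).1 k := by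
  induction m generalizing q v with
  | zero =>
    have h2 := hrec 0 le_rfl
    have h0 := hq 0 le_rfl
    rw [hv0, hv1] at h2
    have e : v (0 + 2) = (1, (q 0 : ℤ)) := by simp [h2]
    rw [e]
    obtain ⟨k, hk⟩ : ∃ k, q 0 = k + 1 := ⟨q 0 - 1, by lia⟩
    refine ⟨one_pos, by simp; lia, k, by simp [hk], ?_, ?_⟩
    · have := hasSail_one_one.add_mul_right one_pos one_pos k
      simpa [hk, add_comm] using this
    · have := hasSail_one_one.add_mul_left one_pos one_pos k
      simpa [hk, add_comm] using this
  | succ m ih =>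
    let w : ℕ → ℤ × ℤ := fun i => ((v (i + 1)).2 - q 0 * (v (i + 1)).1, (v (i + 1)).1)
    have h2 := hrec 0 (by lia)
    rw [hv0, hv1] at h2
    obtain ⟨p1, p2, k, hk, hs, hs'⟩ := ih (fun i => q (i + 1)) w
      (by simp [w, hv1]) (by simp [w, h2])
      (fun i hi => by
        have := hrec (i + 1) (by lia)
        simp only [w, this, Prod.ext_iff, Prod.fst_add, Prod.snd_add, Prod.smul_fst,
          Prod.smul_snd, smul_eq_mul]
        exact ⟨by ring, trivial⟩)
      (fun i hi => hq (i + 1) (by lia))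
    have e1 : (v (m + 1 + 2)).1 = (w (m + 2)).2 := rfl
    have e2 : (v (m + 1 + 2)).2 = (w (m + 2)).1 + q 0 * (w (m + 2)).2 := by
      simp [w]
    rw [e1, e2]
    refine ⟨p2, by positivity, k + q 0, ?_, hs'.add_mul_right p2 p1 _, hs.add_mul_left p1 p2 _⟩
    rw [Finset.sum_range_succ', hk]; lia

/-- The affine function of the second coordinate through the points of index `i` and `i + 1`. -/
noncomputable def chordLine (x y : ℕ → ℤ) (i : ℕ) (z : ℝ) : ℝ :=
  x i + (z - y i) * (((x (i + 1) : ℝ) - x i) / ((y (i + 1) : ℝ) - y i))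

/-- The upper envelope of the chords of index at most `K`. -/
noncomputable def envelope (K : ℕ) (x y : ℕ → ℤ) (z : ℝ) : ℝ :=
  (Finset.range (K + 1)).sup' Finset.nonempty_range_add_one fun i => chordLine x y i z

theorem continuous_envelope (K : ℕ) (x y : ℕ → ℤ) : Continuous (envelope K x y) := by
  unfold envelope
  refine Continuous.finset_sup'_apply _ fun i _ => ?_
  unfold chordLine
  fun_prop

theorem chordLine_combo (x y : ℕ → ℤ) (i : ℕ) (z w s t : ℝ) (hst : s + t = 1) :
    chordLine x y i (s * z + t * w) = s * chordLine x y i z + t * chordLine x y i w := by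
  obtain rfl : t = 1 - s := by linarith
  unfold chordLine
  ring

theorem convexOn_envelope (K : ℕ) (x y : ℕ → ℤ) : ConvexOn ℝ Set.univ (envelope K x y) := by
  refine ⟨convex_univ, fun z _ w _ s t hs ht hst => Finset.sup'_le _ _ fun i hi => ?_⟩
  simp only [smul_eq_mul]
  rw [chordLine_combo x y i z w s t hst]
  exact add_le_add (mul_le_mul_of_nonneg_left (Finset.le_sup' (fun i => chordLine x y i z) hi) hs)
    (mul_le_mul_of_nonneg_left (Finset.le_sup' (fun i => chordLine x y i w) hi) ht)

theorem chordLine_left (x y : ℕ → ℤ) (i : ℕ) : chordLine x y i (y i) = x i := by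
  simp [chordLine]

theorem chordLine_right {x y : ℕ → ℤ} {i : ℕ} (h : y i < y (i + 1)) :
    chordLine x y i (y (i + 1)) = x (i + 1) := by
  have : (0 : ℝ) < (y (i + 1) : ℝ) - y i := by exact_mod_cast sub_pos.2 h
  unfold chordLine
  field_simp
  ring

theorem integral_chordLine {x y : ℕ → ℤ} {i : ℕ} (h : y i < y (i + 1)) :
    ∫ z in (y i : ℝ)..(y (i + 1)), chordLine x y i z =
      (x i + x (i + 1)) / 2 * (y (i + 1) - y i) := by
  have h0 : (0 : ℝ) < (y (i + 1) : ℝ) - y i := by exact_mod_cast sub_pos.2 h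
  have e : ∀ z, HasDerivAt (fun z : ℝ => x i * z + (z - y i) ^ 2 / 2 *
      (((x (i + 1) : ℝ) - x i) / ((y (i + 1) : ℝ) - y i))) (chordLine x y i z) z := by
    intro z
    unfold chordLine
    have h1 : HasDerivAt (fun z : ℝ => z - y i) 1 z := (hasDerivAt_id z).sub_const _
    refine (((hasDerivAt_id z).const_mul (x i : ℝ)).add
      (((h1.pow 2).div_const 2).mul_const _)).congr_deriv ?_
    simp
  rw [intervalIntegral.integral_eq_sub_of_hasDerivAt (fun z _ => e z)]
  · field_simp
    ring
  · apply Continuous.intervalIntegrable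
    unfold chordLine
    fun_prop

namespace IsSail

variable {a n : ℤ} {K : ℕ} {x y : ℕ → ℤ}

theorem snd_lt (h : IsSail a n (K + 1) x y) (ha : 0 < a) (han : a < n) {i : ℕ} (hi : i ≤ K) :
    y i < y (i + 1) := by
  obtain ⟨h1, h2, h3⟩ := h.edge i (by lia)
  refine lt_of_le_of_ne (by lia) fun he => ?_
  obtain ⟨b1, b2, b3, b4, b5⟩ := h.box i (by lia)
  rw [← he, sub_self, isCoprime_zero_right, Int.isUnit_iff] at h3
  have hr := h.right i (by lia) a (n - 1) (by lia) le_rfl (by lia) le_rfl (by nlinarith)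
  have hx : x (i + 1) - x i = 1 := by lia
  rw [hx, ← he] at hr
  have hy : y i = n - 1 := by lia
  obtain ⟨c1, c2, -⟩ := h.box (i + 1) (by lia)
  rw [hy] at b5
  have : x i ≤ a - 1 := by lia
  nlinarith

theorem one_vertex (h : IsSail a n (K + 1) x y) (ha : 0 < a) (han : a < n) :
    x 1 = 1 ∧ y 1 = 1 := by
  obtain ⟨h1, h2, h3⟩ := h.edge 0 (by lia)
  have := h.right 0 (by lia) 1 1 le_rfl (by lia) (by lia) (by lia) (by lia)
  simp only [h.x_zero, h.y_zero, zero_add] at *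
  have hx : x 1 = 1 := by lia
  rw [hx, sub_self, isCoprime_zero_left, Int.isUnit_iff] at h3
  exact ⟨hx, by lia⟩

theorem snd_strictMono (h : IsSail a n (K + 1) x y) (ha : 0 < a) (han : a < n) {i j : ℕ}
    (hij : i < j) (hj : j ≤ K + 1) : y i < y j := by
  induction j, hij using Nat.le_induction with
  | base => exact h.snd_lt ha han (by lia)
  | succ j hij ih => exact (ih (by lia)).trans (h.snd_lt ha han (by lia))

theorem envelope_le (h : IsSail a n (K + 1) x y) (ha : 0 < a) (han : a < n) {X Y : ℤ}
    (hX : 1 ≤ X) (hXa : X ≤ a) (hY : 0 ≤ Y) (hYn : Y ≤ n - 1) (hd : a * Y < n * X) :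
    envelope K x y Y ≤ X := by
  refine Finset.sup'_le _ _ fun i hi => ?_
  rw [Finset.mem_range] at hi
  have h1 := h.right i hi X Y hX hXa hY hYn hd
  have h0 : (0 : ℝ) < (y (i + 1) : ℝ) - y i := by
    exact_mod_cast sub_pos.2 (h.snd_lt ha han (Nat.le_of_lt_succ hi))
  have h2 : ((Y : ℝ) - y i) * (x (i + 1) - x i) ≤ (X - x i) * (y (i + 1) - y i) := by
    exact_mod_cast h1
  unfold chordLine
  rw [← mul_div_assoc, ← le_sub_iff_add_le', div_le_iff₀ h0]
  exact h2

theorem envelope_vertex_le (h : IsSail a n (K + 1) x y) (ha : 0 < a) (han : a < n) {i : ℕ}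
    (hi : i ≤ K + 1) : envelope K x y (y i) ≤ x i := by
  obtain ⟨h1, h2, h3, h4, h5⟩ := h.box i hi
  exact h.envelope_le ha han h1 h2 h3 h4 h5

theorem envelope_eq (h : IsSail a n (K + 1) x y) (ha : 0 < a) (han : a < n) {i : ℕ}
    (hi : i ≤ K) {z : ℝ} (hz : (y i : ℝ) ≤ z) (hz' : z ≤ y (i + 1)) :
    envelope K x y z = chordLine x y i z := by
  refine le_antisymm ?_ (Finset.le_sup' (fun i => chordLine x y i z)
    (Finset.mem_range.2 (by lia)))
  have hlt := h.snd_lt ha han hi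
  obtain ⟨s, t, hs, ht, hst, rfl⟩ := (segment_eq_Icc (hz.trans hz')).symm ▸ Set.mem_Icc.2 ⟨hz, hz'⟩
  refine ((convexOn_envelope K x y).2 trivial trivial hs ht hst).trans ?_
  simp only [smul_eq_mul]
  rw [chordLine_combo x y i _ _ s t hst, chordLine_left, chordLine_right hlt]
  exact add_le_add
    (mul_le_mul_of_nonneg_left (h.envelope_vertex_le ha han (by lia)) hs)
    (mul_le_mul_of_nonneg_left (h.envelope_vertex_le ha han (by lia)) ht)

theorem envelope_vertex (h : IsSail a n (K + 1) x y) (ha : 0 < a) (han : a < n) {i : ℕ}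
    (hi : i ≤ K + 1) : envelope K x y (y i) = x i := by
  rcases Nat.lt_or_eq_of_le hi with hi | rfl
  · rw [h.envelope_eq ha han (Nat.le_of_lt_succ hi) le_rfl, chordLine_left]
    exact_mod_cast (h.snd_lt ha han (Nat.le_of_lt_succ hi)).le
  · have := h.snd_lt ha han le_rfl
    rw [h.envelope_eq ha han le_rfl _ le_rfl, chordLine_right this]
    exact_mod_cast this.le

theorem exists_chord (h : IsSail a n (K + 1) x y) {z : ℝ} (hz : 0 ≤ z) (hzn : z < n - 1) :
    ∃ i ≤ K, (y i : ℝ) ≤ z ∧ z < y (i + 1) := by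
  have h1 : ∃ i, z < y i := ⟨K + 1, by rw [h.y_last]; push_cast; exact hzn⟩
  classical
  have hp : Nat.find h1 ≠ 0 := fun h0 => by
    have := Nat.find_spec h1
    rw [h0, h.y_zero] at this
    push_cast at this
    linarith
  obtain ⟨i, hi⟩ := Nat.exists_eq_succ_of_ne_zero hp
  have hle : Nat.find h1 ≤ K + 1 := Nat.find_min' h1 (by rw [h.y_last]; push_cast; exact hzn)
  refine ⟨i, by lia, not_lt.1 (Nat.find_min h1 (by lia)), ?_⟩
  have := Nat.find_spec h1
  rwa [hi] at this

theorem eq_vertex (h : IsSail a n (K + 1) x y) (ha : 0 < a) (han : a < n) {X Y : ℤ}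
    (hY : 1 ≤ Y) (hYn : Y ≤ n - 1) (he : envelope K x y Y = X) :
    ∃ i, 1 ≤ i ∧ i ≤ K + 1 ∧ X = x i ∧ Y = y i := by
  rcases eq_or_lt_of_le hYn with rfl | hlt
  · refine ⟨K + 1, by lia, le_rfl, ?_, h.y_last.symm⟩
    rw [← h.y_last, h.envelope_vertex ha han le_rfl] at he
    exact_mod_cast he.symm
  obtain ⟨i, hi, h1, h2⟩ := h.exists_chord (z := Y) (by exact_mod_cast (by lia : (0 : ℤ) ≤ Y))
    (by exact_mod_cast hlt)
  rw [h.envelope_eq ha han hi h1 h2.le] at he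
  have hlt := h.snd_lt ha han hi
  have h0 : (0 : ℝ) < (y (i + 1) : ℝ) - y i := by exact_mod_cast sub_pos.2 hlt
  have e : ((Y : ℝ) - y i) * (x (i + 1) - x i) = (X - x i) * (y (i + 1) - y i) := by
    rw [← he, chordLine]
    field_simp
    ring
  have e' : (Y - y i) * (x (i + 1) - x i) = (X - x i) * (y (i + 1) - y i) := by
    exact_mod_cast e
  have hdvd : y (i + 1) - y i ∣ Y - y i :=
    (h.edge i (by lia)).2.2.symm.dvd_of_dvd_mul_right ⟨X - x i, by rw [e', mul_comm]⟩
  have h1' : y i ≤ Y := by exact_mod_cast h1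
  have h2' : Y < y (i + 1) := by exact_mod_cast h2
  have hYi : Y - y i = 0 := Int.eq_zero_of_dvd_of_nonneg_of_lt (by lia) (by lia) hdvd
  refine ⟨i, ?_, by lia, ?_, by lia⟩
  · rcases Nat.eq_zero_or_pos i with rfl | h
    · have := h.y_zero; lia
    · exact h
  · have : Y = y i := by lia
    rw [this, chordLine_left] at he
    exact_mod_cast he.symm

theorem integral_envelope (h : IsSail a n (K + 1) x y) (ha : 0 < a) (han : a < n) :
    ∫ z in (1 : ℝ)..(n - 1), envelope K x y z = (K + a * (n - 2)) / 2 := by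
  have hint : ∀ u v : ℝ, IntervalIntegrable (envelope K x y) MeasureTheory.volume u v :=
    fun u v => (continuous_envelope K x y).intervalIntegrable u v
  have hpiece : ∀ i ≤ K, ∫ z in (y i : ℝ)..(y (i + 1)), envelope K x y z =
      (x i + x (i + 1)) / 2 * (y (i + 1) - y i) := fun i hi => by
    have hlt := h.snd_lt ha han hi
    rw [← integral_chordLine hlt]
    refine intervalIntegral.integral_congr fun z hz => ?_
    rw [Set.uIcc_of_le (by exact_mod_cast hlt.le)] at hz
    exact h.envelope_eq ha han hi hz.1 hz.2
  have hsum := intervalIntegral.sum_integral_adjacent_intervals (f := envelope K x y)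
    (a := fun i => (y i : ℝ)) (n := K + 1) fun i _ => hint _ _
  obtain ⟨hx1, hy1⟩ := h.one_vertex ha han
  have h01 := hpiece 0 (by lia)
  simp only [zero_add, hx1, hy1, h.x_zero, h.y_zero] at h01
  rw [Finset.sum_congr rfl fun i hi => hpiece i (by simp at hi; lia)] at hsum
  have hadd := intervalIntegral.integral_add_adjacent_intervals (hint (0 : ℝ) 1) (hint 1 (n - 1))
  have harea : ∑ i ∈ Finset.range (K + 1),
      (((x i : ℝ) + x (i + 1)) / 2 * (y (i + 1) - y i)) =
      (((K + 1 : ℕ) : ℝ) + 1 - a + a * (n - 1)) / 2 := by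
    have h1 := h.area
    have h2 := Finset.sum_range_sub (fun i => x i * y i) (K + 1)
    rw [h.x_last, h.y_last, h.x_zero, h.y_zero] at h2
    have h3 : ((K + 1 : ℕ) : ℝ) + 1 - a + a * (n - 1) =
      ∑ i ∈ Finset.range (K + 1), ((x i : ℝ) * y (i + 1) - x (i + 1) * y i) +
      ∑ i ∈ Finset.range (K + 1), ((x (i + 1) : ℝ) * y (i + 1) - x i * y i) := by
      have h1' := congrArg (Int.cast : ℤ → ℝ) h1
      have h2' := congrArg (Int.cast : ℤ → ℝ) h2
      push_cast at h1' h2'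
      rw [h1', h2']
      push_cast
      ring
    rw [h3, ← Finset.sum_add_distrib, Finset.sum_div]
    exact Finset.sum_congr rfl fun i _ => by ring
  rw [harea] at hsum
  simp only [h.y_zero, h.y_last] at hsum
  push_cast at hsum h01
  linarith

end IsSail

/-- The closed region between the graphs of `F` and `G`, viewed as functions of the second
coordinate. -/
def strip (l r : ℝ) (F G : ℝ → ℝ) : Set (ℝ × ℝ) :=
  {p | (l ≤ p.2 ∧ p.2 ≤ r) ∧ F p.2 ≤ p.1 ∧ p.1 ≤ G p.2}

section strip

variable {l r : ℝ} {F G : ℝ → ℝ}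

theorem isClosed_strip (hF : Continuous F) (hG : Continuous G) : IsClosed (strip l r F G) :=
  ((isClosed_le continuous_const continuous_snd).inter
    (isClosed_le continuous_snd continuous_const)).inter
    ((isClosed_le (hF.comp continuous_snd) continuous_fst).inter
      (isClosed_le continuous_fst (hG.comp continuous_snd)))

theorem mem_interior_strip (hF : Continuous F) (hG : Continuous G) {p : ℝ × ℝ} :
    p ∈ interior (strip l r F G) ↔ (l < p.2 ∧ p.2 < r) ∧ F p.2 < p.1 ∧ p.1 < G p.2 := by
  constructor
  · intro hp
    rw [mem_interior_iff_mem_nhds, Metric.mem_nhds_iff] at hp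
    obtain ⟨ε, hε, hs⟩ := hp
    have key : ∀ u v : ℝ, |u| < ε → |v| < ε → (p.1 + u, p.2 + v) ∈ strip l r F G := by
      intro u v hu hv
      apply hs
      rw [Metric.mem_ball, Prod.dist_eq, Real.dist_eq, Real.dist_eq]
      simpa using ⟨hu, hv⟩
    have h0 : |(0 : ℝ)| < ε := by simpa
    have h1 : |ε / 2| < ε := by rw [abs_of_pos (by linarith)]; linarith
    have h2 : |-(ε / 2)| < ε := by rwa [abs_neg]
    have k1 := key 0 _ h0 h1
    have k2 := key 0 _ h0 h2
    have k3 := key _ 0 h1 h0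
    have k4 := key _ 0 h2 h0
    simp only [strip, Set.mem_ofPred_eq, add_zero] at k1 k2 k3 k4
    exact ⟨⟨by linarith [k2.1.1], by linarith [k1.1.2]⟩,
      by linarith [k4.2.1], by linarith [k3.2.2]⟩
  · intro hp
    have ho : IsOpen {p : ℝ × ℝ | (l < p.2 ∧ p.2 < r) ∧ F p.2 < p.1 ∧ p.1 < G p.2} :=
      ((isOpen_lt continuous_const continuous_snd).inter
        (isOpen_lt continuous_snd continuous_const)).inter
        ((isOpen_lt (hF.comp continuous_snd) continuous_fst).inter
          (isOpen_lt continuous_fst (hG.comp continuous_snd)))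
    refine interior_maximal (fun q hq => ?_) ho hp
    obtain ⟨⟨h1, h2⟩, h3, h4⟩ := hq
    exact ⟨⟨h1.le, h2.le⟩, h3.le, h4.le⟩

theorem convex_strip (hF : ConvexOn ℝ Set.univ F) (hG : ConcaveOn ℝ Set.univ G) :
    Convex ℝ (strip l r F G) := by
  intro p hp q hq s t hs ht hst
  have h1 := hF.2 (Set.mem_univ p.2) (Set.mem_univ q.2) hs ht hst
  have h2 := hG.2 (Set.mem_univ p.2) (Set.mem_univ q.2) hs ht hst
  have h3 := convex_Icc l r hp.1 hq.1 hs ht hst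
  refine ⟨h3, h1.trans ?_, le_trans ?_ h2⟩
  · exact add_le_add (mul_le_mul_of_nonneg_left hp.2.1 hs) (mul_le_mul_of_nonneg_left hq.2.1 ht)
  · exact add_le_add (mul_le_mul_of_nonneg_left hp.2.2 hs) (mul_le_mul_of_nonneg_left hq.2.2 ht)

theorem volume_strip (hlr : l ≤ r) (hF : Continuous F) (hG : Continuous G)
    (hFG : ∀ z, l ≤ z → z ≤ r → F z ≤ G z) :
    (MeasureTheory.volume (strip l r F G)).toReal = ∫ z in l..r, (G z - F z) := by
  have e : ∀ z, MeasureTheory.volume ((fun w : ℝ => (w, z)) ⁻¹' strip l r F G) =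
      (Set.Icc l r).indicator (fun z => ENNReal.ofReal (G z - F z)) z := by
    intro z
    by_cases hz : z ∈ Set.Icc l r
    · rw [Set.indicator_of_mem hz, ← Real.volume_Icc]
      congr 1
      ext w
      exact ⟨fun h => h.2, fun h => ⟨hz, h⟩⟩
    · rw [Set.indicator_of_notMem hz]
      convert MeasureTheory.measure_empty (μ := MeasureTheory.volume)
      ext w
      exact ⟨fun h => hz h.1, fun h => h.elim⟩
  rw [MeasureTheory.Measure.volume_eq_prod,
    MeasureTheory.Measure.prod_apply_symm (isClosed_strip hF hG).measurableSet]
  simp only [e]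
  rw [MeasureTheory.lintegral_indicator measurableSet_Icc, intervalIntegral.integral_of_le hlr,
    ← MeasureTheory.integral_Icc_eq_integral_Ioc,
    MeasureTheory.integral_eq_lintegral_of_nonneg_ae]
  · filter_upwards [MeasureTheory.ae_restrict_mem measurableSet_Icc] with z hz
    exact sub_nonneg.2 (hFG z hz.1 hz.2)
  · exact (hG.sub hF).aestronglyMeasurable

end strip

theorem Pan_eq_strip {a n : ℕ} (hn : 0 < n) :
    Pan a n = strip 0 n (fun z => a * z / n) (fun z => a * z / n + 1) := by
  have hn' : (0 : ℝ) < n := by exact_mod_cast hn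
  apply Set.Subset.antisymm
  · refine convexHull_min ?_ (convex_strip ?_ ?_)
    · rintro p (rfl | rfl | rfl | rfl) <;> simp [strip, hn'.ne', hn'.le]
    · refine ⟨convex_univ, fun z _ w _ s t _ _ _ => le_of_eq ?_⟩
      simp only [smul_eq_mul]
      ring
    · refine ⟨convex_univ, fun z _ w _ s t _ _ hst => le_of_eq ?_⟩
      obtain rfl : t = 1 - s := by linarith
      simp only [smul_eq_mul]
      ring
  · rintro ⟨u, z⟩ ⟨⟨h0, h1⟩, h2, h3⟩
    change 0 ≤ z at h0
    change z ≤ n at h1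
    change a * z / n ≤ u at h2
    change u ≤ a * z / n + 1 at h3
    have m1 : ((0 : ℝ), (0 : ℝ)) ∈ Pan a n := subset_convexHull ℝ _ (by simp)
    have m2 : ((1 : ℝ), (0 : ℝ)) ∈ Pan a n := subset_convexHull ℝ _ (by simp)
    have m3 : ((a : ℝ), (n : ℝ)) ∈ Pan a n := subset_convexHull ℝ _ (by simp)
    have m4 : ((a : ℝ) + 1, (n : ℝ)) ∈ Pan a n := subset_convexHull ℝ _ (by simp)
    have hc : Convex ℝ (Pan a n) := convex_convexHull ℝ _
    have ht0 : 0 ≤ z / n := by positivity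
    have ht1 : 0 ≤ 1 - z / n := by rw [sub_nonneg, div_le_one hn']; exact h1
    have hl := hc m1 m3 ht1 ht0 (by ring)
    have hr := hc m2 m4 ht1 ht0 (by ring)
    have := hc hl hr (by linarith : 0 ≤ 1 - (u - a * z / n)) (by linarith : 0 ≤ u - a * z / n)
      (by ring)
    convert this using 1
    ext <;> simp <;> field_simp <;> ring

theorem mem_interior_Pan {a n : ℕ} (hn : 0 < n) (X Y : ℤ) :
    ((X : ℝ), (Y : ℝ)) ∈ interior (Pan a n) ↔
      (0 < Y ∧ Y < n) ∧ a * Y < n * X ∧ n * X < a * Y + n := by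
  have hn' : (0 : ℝ) < n := by exact_mod_cast hn
  rw [Pan_eq_strip hn, mem_interior_strip (by fun_prop) (by fun_prop)]
  simp only
  rw [div_lt_iff₀ hn', ← sub_lt_iff_lt_add, lt_div_iff₀ hn']
  refine and_congr (and_congr ?_ ?_) (and_congr ?_ ?_)
  · norm_cast
  · norm_cast
  · rw [mul_comm (X : ℝ)]
    norm_cast
  · rw [sub_mul, sub_lt_iff_lt_add, mul_comm (X : ℝ), one_mul]
    norm_cast

theorem volume_Pan {a n : ℕ} (hn : 0 < n) : (MeasureTheory.volume (Pan a n)).toReal = n := by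
  rw [Pan_eq_strip hn, volume_strip (by positivity) (by fun_prop) (by fun_prop)]
  · simp
  · intros; simp

/-- The reflection of the envelope through the centre of the parallelogram. -/
noncomputable def reflEnvelope (a n : ℕ) (K : ℕ) (x y : ℕ → ℤ) (z : ℝ) : ℝ :=
  a + 1 - envelope K x y (n - z)

theorem continuous_reflEnvelope (a n K : ℕ) (x y : ℕ → ℤ) :
    Continuous (reflEnvelope a n K x y) :=
  continuous_const.sub ((continuous_envelope K x y).comp (continuous_const.sub continuous_id))

theorem concaveOn_reflEnvelope (a n K : ℕ) (x y : ℕ → ℤ) :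
    ConcaveOn ℝ Set.univ (reflEnvelope a n K x y) := by
  refine ⟨convex_univ, fun z _ w _ s t hs ht hst => ?_⟩
  have h := (convexOn_envelope K x y).2 (Set.mem_univ (n - z : ℝ)) (Set.mem_univ (n - w : ℝ))
    hs ht hst
  obtain rfl : t = 1 - s := by linarith
  simp only [smul_eq_mul, reflEnvelope] at h ⊢
  rw [show (n : ℝ) - (s * z + (1 - s) * w) = s * (n - z) + (1 - s) * (n - w) by ring]
  linarith

theorem reflEnvelope_sub (a n K : ℕ) (x y : ℕ → ℤ) (z : ℝ) :
    reflEnvelope a n K x y (n - z) = a + 1 - envelope K x y z := by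
  simp [reflEnvelope]

theorem interior_Pan_refl {a n : ℕ} (hn : 0 < n) {X Y : ℤ}
    (h : ((X : ℝ), (Y : ℝ)) ∈ interior (Pan a n)) :
    ((((a + 1 - X : ℤ)) : ℝ), ((n - Y : ℤ) : ℝ)) ∈ interior (Pan a n) := by
  rw [mem_interior_Pan hn] at *
  obtain ⟨⟨h1, h2⟩, h3, h4⟩ := h
  refine ⟨⟨by lia, by lia⟩, ?_, ?_⟩ <;> nlinarith

theorem hull_refl {a n : ℕ} (hn : 0 < n) {p : ℝ × ℝ}
    (hp : p ∈ convexHull ℝ (interior (Pan a n) ∩ latt)) :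
    ((a : ℝ) + 1 - p.1, (n : ℝ) - p.2) ∈ convexHull ℝ (interior (Pan a n) ∩ latt) := by
  let σ : ℝ × ℝ →ᵃ[ℝ] ℝ × ℝ :=
    AffineMap.const ℝ (ℝ × ℝ) ((a : ℝ) + 1, (n : ℝ)) - AffineMap.id ℝ (ℝ × ℝ)
  have hσ : ∀ q, σ q = ((a : ℝ) + 1 - q.1, (n : ℝ) - q.2) := fun q => rfl
  have hc := (convex_convexHull ℝ (interior (Pan a n) ∩ latt)).affine_preimage σ
  have := convexHull_min (s := interior (Pan a n) ∩ latt) ?_ hc hp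
  · exact this
  · rintro q ⟨hq, ⟨X, Y⟩, rfl⟩
    refine subset_convexHull ℝ _ ⟨?_, (a + 1 - X, n - Y), ?_⟩
    · have := interior_Pan_refl hn hq
      rw [hσ]
      push_cast at this
      exact this
    · rw [hσ]
      push_cast
      rfl

namespace IsSail

variable {a n K : ℕ} {x y : ℕ → ℤ}

theorem envelope_le_of_interior (h : IsSail a n (K + 1) x y) (ha : 0 < a) (han : a < n) {X Y : ℤ}
    (hp : ((X : ℝ), (Y : ℝ)) ∈ interior (Pan a n)) : envelope K x y Y ≤ X := by
  rw [mem_interior_Pan (by lia)] at hp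
  obtain ⟨⟨h1, h2⟩, h3, h4⟩ := hp
  have ha' : (0 : ℤ) < a := by exact_mod_cast ha
  have hX : 0 < X := by
    by_contra! hX
    nlinarith
  have hXa : X < a + 1 := by
    by_contra! hXa
    nlinarith
  exact h.envelope_le (by lia) (by lia) (by lia) (by lia) h1.le (by lia) h3

theorem le_reflEnvelope_of_interior (h : IsSail a n (K + 1) x y) (ha : 0 < a) (han : a < n)
    {X Y : ℤ} (hp : ((X : ℝ), (Y : ℝ)) ∈ interior (Pan a n)) :
    X ≤ reflEnvelope a n K x y Y := by
  have := h.envelope_le_of_interior ha han (interior_Pan_refl (by lia) hp)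
  push_cast at this
  unfold reflEnvelope
  linarith

theorem vertex_mem_interior (h : IsSail a n (K + 1) x y) (ha : 0 < a) (han : a < n)
    (hco : Nat.Coprime a n) {i : ℕ} (hi : 1 ≤ i) (hiK : i ≤ K + 1) :
    ((x i : ℝ), (y i : ℝ)) ∈ interior (Pan a n) := by
  have ha' : (0 : ℤ) < a := by exact_mod_cast ha
  have han' : (a : ℤ) < n := by exact_mod_cast han
  rw [mem_interior_Pan (by lia)]
  obtain ⟨h1, h2, h3, h4, h5⟩ := h.box i hiK
  have hy : 0 < y i := by
    have := h.snd_strictMono ha' han' hi hiK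
    rwa [h.y_zero] at this
  refine ⟨⟨hy, by lia⟩, h5, ?_⟩
  by_contra! hge
  rcases eq_or_lt_of_le hge with he | hlt
  · have hd : (n : ℤ) ∣ a * y i := ⟨x i - 1, by linarith⟩
    have := (Nat.isCoprime_iff_coprime.2 hco.symm).dvd_of_dvd_mul_left hd
    have := Int.le_of_dvd hy this
    lia
  · have hx : 0 < x i - 1 := by
      by_contra! hx
      nlinarith
    have := h.envelope_le ha' han' (X := x i - 1) (by lia) (by lia) h3 h4 (by linarith)
    rw [h.envelope_vertex ha' han' hiK] at this
    push_cast at this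
    linarith

theorem envelope_mem_hull (h : IsSail a n (K + 1) x y) (ha : 0 < a) (han : a < n)
    (hco : Nat.Coprime a n) {z : ℝ} (hz : 1 ≤ z) (hzn : z ≤ n - 1) :
    (envelope K x y z, z) ∈ convexHull ℝ (interior (Pan a n) ∩ latt) := by
  have ha' : (0 : ℤ) < a := by exact_mod_cast ha
  have han' : (a : ℤ) < n := by exact_mod_cast han
  have hv : ∀ i, 1 ≤ i → i ≤ K + 1 →
      ((x i : ℝ), (y i : ℝ)) ∈ convexHull ℝ (interior (Pan a n) ∩ latt) := fun i hi hiK =>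
    subset_convexHull ℝ _ ⟨h.vertex_mem_interior ha han hco hi hiK, (x i, y i), rfl⟩
  rcases eq_or_lt_of_le hzn with rfl | hlt
  · have := h.envelope_vertex ha' han' le_rfl
    have hK := hv (K + 1) (by lia) le_rfl
    rw [h.y_last] at this hK
    push_cast at this hK
    rwa [this]
  obtain ⟨i, hi, h1, h2⟩ := h.exists_chord (z := z) (by linarith) (by push_cast; exact hlt)
  have hi1 : 1 ≤ i := by
    by_contra! hi0
    obtain rfl : i = 0 := by lia
    rw [zero_add, (h.one_vertex ha' han').2] at h2
    push_cast at h2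
    linarith
  rw [h.envelope_eq ha' han' hi h1 h2.le]
  obtain ⟨s, t, hs, ht, hst, rfl⟩ :=
    (segment_eq_Icc (h1.trans h2.le)).symm ▸ Set.mem_Icc.2 ⟨h1, h2.le⟩
  have := convex_convexHull ℝ _ (hv i hi1 (by lia)) (hv (i + 1) (by lia) (by lia)) hs ht hst
  simp only [smul_eq_mul]
  rw [chordLine_combo x y i _ _ s t hst, chordLine_left,
    chordLine_right (h.snd_lt ha' han' hi)]
  exact this

theorem hull_eq (h : IsSail a n (K + 1) x y) (ha : 0 < a) (han : a < n)
    (hco : Nat.Coprime a n) :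
    convexHull ℝ (interior (Pan a n) ∩ latt) =
      strip 1 (n - 1) (envelope K x y) (reflEnvelope a n K x y) := by
  apply Set.Subset.antisymm
  · refine convexHull_min ?_
      (convex_strip (convexOn_envelope K x y) (concaveOn_reflEnvelope a n K x y))
    rintro q ⟨hq, ⟨X, Y⟩, rfl⟩
    have hq' := hq
    rw [mem_interior_Pan (by lia)] at hq'
    refine ⟨⟨?_, ?_⟩, h.envelope_le_of_interior ha han hq, h.le_reflEnvelope_of_interior ha han hq⟩
    · change (1 : ℝ) ≤ Y
      exact_mod_cast hq'.1.1
    · change (Y : ℝ) ≤ n - 1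
      rw [le_sub_iff_add_le]
      exact_mod_cast hq'.1.2
  · rintro ⟨u, z⟩ ⟨⟨h0, h1⟩, h2, h3⟩
    change 1 ≤ z at h0
    change z ≤ n - 1 at h1
    change envelope K x y z ≤ u at h2
    change u ≤ reflEnvelope a n K x y z at h3
    have hl := h.envelope_mem_hull ha han hco h0 h1
    have hr := hull_refl (by lia) (h.envelope_mem_hull ha han hco
      (by linarith : (1 : ℝ) ≤ n - z) (by linarith))
    simp only [sub_sub_cancel] at hr
    change (reflEnvelope a n K x y z, z) ∈ _ at hr
    obtain ⟨s, t, hs, ht, hst, rfl⟩ :=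
      (segment_eq_Icc (h2.trans h3)).symm ▸ Set.mem_Icc.2 ⟨h2, h3⟩
    have := convex_convexHull ℝ _ hl hr hs ht hst
    convert this using 1
    ext
    · simp
    · simp [← add_mul, hst]

theorem envelope_ends (h : IsSail a n (K + 1) x y) (ha : 0 < a) (han : a < n) :
    envelope K x y 1 = 1 ∧ envelope K x y (n - 1) = a := by
  have ha' : (0 : ℤ) < a := by exact_mod_cast ha
  have han' : (a : ℤ) < n := by exact_mod_cast han
  have h1 := h.envelope_vertex ha' han' (i := 1) (by lia)
  have h2 := h.envelope_vertex ha' han' le_rfl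
  rw [(h.one_vertex ha' han').1, (h.one_vertex ha' han').2] at h1
  rw [h.x_last, h.y_last] at h2
  push_cast at h1 h2
  exact ⟨h1, h2⟩

theorem reflEnvelope_ends (h : IsSail a n (K + 1) x y) (ha : 0 < a) (han : a < n) :
    reflEnvelope a n K x y 1 = 1 ∧ reflEnvelope a n K x y (n - 1) = a := by
  obtain ⟨h1, h2⟩ := h.envelope_ends ha han
  rw [reflEnvelope_sub, h1, reflEnvelope, h2]
  constructor <;> ring

theorem envelope_le_reflEnvelope (h : IsSail a n (K + 1) x y) (ha : 0 < a) (han : a < n)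
    {z : ℝ} (hz : 1 ≤ z) (hzn : z ≤ n - 1) :
    envelope K x y z ≤ reflEnvelope a n K x y z := by
  obtain ⟨h1, h2⟩ := h.envelope_ends ha han
  obtain ⟨h3, h4⟩ := h.reflEnvelope_ends ha han
  obtain ⟨s, t, hs, ht, hst, rfl⟩ :=
    (segment_eq_Icc (hz.trans hzn)).symm ▸ Set.mem_Icc.2 ⟨hz, hzn⟩
  have h5 := (convexOn_envelope K x y).2 trivial trivial hs ht hst (x := 1) (y := (n - 1 : ℝ))
  have h6 := (concaveOn_reflEnvelope a n K x y).2 trivial trivial hs ht hst (x := 1)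
    (y := (n - 1 : ℝ))
  rw [h1, h2] at h5
  rw [h3, h4] at h6
  exact h5.trans h6

theorem volume_hull (h : IsSail a n (K + 1) x y) (ha : 0 < a) (han : a < n)
    (hco : Nat.Coprime a n) :
    (MeasureTheory.volume (convexHull ℝ (interior (Pan a n) ∩ latt))).toReal = n - (K + 2) := by
  have ha' : (0 : ℤ) < a := by exact_mod_cast ha
  have han' : (a : ℤ) < n := by exact_mod_cast han
  have hn2 : (2 : ℝ) ≤ n := by exact_mod_cast (by lia : 2 ≤ n)
  have hi := h.integral_envelope ha' han'
  push_cast at hi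
  rw [h.hull_eq ha han hco, volume_strip (by linarith) (continuous_envelope K x y)
    (continuous_reflEnvelope a n K x y)
    (fun z hz hz' => h.envelope_le_reflEnvelope ha han hz hz'),
    intervalIntegral.integral_sub
      ((continuous_reflEnvelope a n K x y).intervalIntegrable _ _)
      ((continuous_envelope K x y).intervalIntegrable _ _), hi]
  have hc : Continuous fun z : ℝ => envelope K x y (n - z) :=
    (continuous_envelope K x y).comp (continuous_const.sub continuous_id)
  simp only [reflEnvelope]
  rw [intervalIntegral.integral_sub (by simp) (hc.intervalIntegrable _ _),
    intervalIntegral.integral_comp_sub_left (fun z => envelope K x y z) (n : ℝ),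
    intervalIntegral.integral_const, sub_sub_cancel, hi, smul_eq_mul]
  ring

theorem exists_interior_of_snd {a n : ℕ} (hn : 0 < n) (hco : Nat.Coprime a n) {Y : ℤ}
    (hY : 0 < Y) (hYn : Y < n) : ∃ X : ℤ, ((X : ℝ), (Y : ℝ)) ∈ interior (Pan a n) := by
  have hn' : (0 : ℤ) < n := by exact_mod_cast hn
  refine ⟨a * Y / n + 1, ?_⟩
  rw [mem_interior_Pan hn]
  have h1 := Int.emod_add_mul_ediv (a * Y) n
  have h2 := Int.emod_lt_of_pos (a * Y) hn'
  have h3 : 0 < a * Y % n := by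
    refine lt_of_le_of_ne (Int.emod_nonneg _ hn'.ne') fun he => ?_
    have hd := Int.dvd_of_emod_eq_zero he.symm
    have := (Nat.isCoprime_iff_coprime.2 hco.symm).dvd_of_dvd_mul_left hd
    have := Int.le_of_dvd hY this
    lia
  refine ⟨⟨hY, hYn⟩, ?_, ?_⟩ <;> rw [mul_add, mul_one] <;> lia

theorem envelope_lt_reflEnvelope (h : IsSail a n (K + 1) x y) (ha : 1 < a) (han : a < n - 1)
    (hco : Nat.Coprime a n) {Y : ℤ} (hY : 1 < Y) (hYn : Y < n - 1) :
    envelope K x y Y < reflEnvelope a n K x y Y := by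
  obtain ⟨h1, h2⟩ := h.envelope_ends (by lia) (by lia)
  obtain ⟨h3, h4⟩ := h.reflEnvelope_ends (by lia) (by lia)
  have hY2 : (2 : ℝ) ≤ Y := by exact_mod_cast hY
  have hYn' : (Y : ℝ) < n - 1 := by exact_mod_cast hYn
  have hn : (4 : ℝ) ≤ n := by exact_mod_cast (by lia : 4 ≤ n)
  have hc := convexOn_envelope K x y
  have hc' := concaveOn_reflEnvelope a n K x y
  have hlt : envelope K x y 2 < reflEnvelope a n K x y 2 := by
    refine lt_of_le_of_ne (h.envelope_le_reflEnvelope (by lia) (by lia) (by norm_num)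
      (by linarith)) fun he => ?_
    obtain ⟨X, hX⟩ := exists_interior_of_snd (a := a) (n := n) (by lia) hco (Y := 2)
      (by norm_num) (by lia)
    have e1 := h.envelope_le_of_interior (by lia) (by lia) hX
    have e2 := h.le_reflEnvelope_of_interior (by lia) (by lia) hX
    have hpos : (0 : ℝ) < n - 2 := by linarith
    have hs : 0 ≤ ((n : ℝ) - 3) / (n - 2) := div_nonneg (by linarith) hpos.le
    have ht : 0 ≤ 1 / ((n : ℝ) - 2) := by positivity
    have hst : ((n : ℝ) - 3) / (n - 2) + 1 / (n - 2) = 1 := by field_simp; ring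
    have k1 := hc.2 trivial trivial hs ht hst (x := 1) (y := (n - 1 : ℝ))
    have k2 := hc'.2 trivial trivial hs ht hst (x := 1) (y := (n - 1 : ℝ))
    have e : ((n : ℝ) - 3) / (n - 2) * 1 + 1 / (n - 2) * (n - 1) = 2 := by field_simp; ring
    simp only [smul_eq_mul, e] at k1 k2
    rw [h1, h2] at k1
    rw [h3, h4] at k2
    push_cast at e1 e2
    have hXe : (X : ℝ) = (n - 3) / (n - 2) * 1 + 1 / (n - 2) * a := by linarith
    field_simp at hXe
    have hXe' : (X - 1) * (n - 2 : ℤ) = (a : ℤ) - 1 := by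
      have : ((X : ℝ) - 1) * (n - 2) = a - 1 := by linarith
      exact_mod_cast this
    have hX0 : 0 < X - 1 := by
      by_contra! hX0
      nlinarith
    have han' : (a : ℤ) + 1 < n := by lia
    nlinarith
  have hpos : (0 : ℝ) < n - 3 := by linarith
  have hs : 0 < ((n : ℝ) - 1 - Y) / (n - 3) := div_pos (by linarith) hpos
  have ht : 0 ≤ ((Y : ℝ) - 2) / (n - 3) := div_nonneg (by linarith) hpos.le
  have hst : ((n : ℝ) - 1 - Y) / (n - 3) + (Y - 2) / (n - 3) = 1 := by field_simp; ring
  have k1 := hc.2 trivial trivial hs.le ht hst (x := 2) (y := (n - 1 : ℝ))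
  have k2 := hc'.2 trivial trivial hs.le ht hst (x := 2) (y := (n - 1 : ℝ))
  have e : ((n : ℝ) - 1 - Y) / (n - 3) * 2 + (Y - 2) / (n - 3) * (n - 1) = Y := by
    field_simp; ring
  simp only [smul_eq_mul, e] at k1 k2
  rw [h2] at k1
  rw [h4] at k2
  have := mul_lt_mul_of_pos_left hlt hs
  linarith

theorem frontier_hull_inter_latt (h : IsSail a n (K + 1) x y) (ha : 0 < a) (han : a < n)
    (hco : Nat.Coprime a n) :
    frontier (convexHull ℝ (interior (Pan a n) ∩ latt)) ∩ latt =
      (fun z : ℤ × ℤ => ((z.1 : ℝ), (z.2 : ℝ))) ''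
        ((Finset.Icc 1 (K + 1)).image (fun i => (x i, y i)) ∪
          (Finset.Icc 1 (K + 1)).image (fun i => ((a : ℤ) + 1 - x i, (n : ℤ) - y i)) :
            Finset (ℤ × ℤ)) := by
  have ha' : (0 : ℤ) < a := by exact_mod_cast ha
  have han' : (a : ℤ) < n := by exact_mod_cast han
  have hint : ∀ X Y : ℤ, ((X : ℝ), (Y : ℝ)) ∈ interior (Pan a n) →
      (envelope K x y Y = X ∨ reflEnvelope a n K x y Y = X) →
      ((X : ℝ), (Y : ℝ)) ∈ frontier (convexHull ℝ (interior (Pan a n) ∩ latt)) := by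
    intro X Y hp he
    refine ⟨subset_closure (subset_convexHull ℝ _ ⟨hp, (X, Y), rfl⟩), ?_⟩
    rw [h.hull_eq ha han hco, mem_interior_strip (continuous_envelope K x y)
      (continuous_reflEnvelope a n K x y)]
    rintro ⟨-, h1, h2⟩
    rcases he with he | he
    · exact h1.ne he
    · exact h2.ne' he
  ext p
  constructor
  · rintro ⟨hp, ⟨X, Y⟩, rfl⟩
    refine ⟨(X, Y), ?_, rfl⟩
    rw [h.hull_eq ha han hco, (isClosed_strip (continuous_envelope K x y)
      (continuous_reflEnvelope a n K x y)).frontier_eq, Set.mem_sdiff,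
      mem_interior_strip (continuous_envelope K x y) (continuous_reflEnvelope a n K x y)] at hp
    obtain ⟨⟨⟨h1, h2⟩, h3, h4⟩, hn⟩ := hp
    simp only at h1 h2 h3 h4 hn
    have hY1 : 1 ≤ Y := by exact_mod_cast h1
    have hY2 : Y ≤ n - 1 := by exact_mod_cast h2
    have hl : envelope K x y Y = X → (X, Y) ∈ (Finset.Icc 1 (K + 1)).image
        (fun i => (x i, y i)) := fun he => by
      obtain ⟨i, hi1, hi2, rfl, rfl⟩ := h.eq_vertex ha' han' hY1 hY2 he
      exact Finset.mem_image_of_mem _ (Finset.mem_Icc.2 ⟨hi1, hi2⟩)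
    have hr : reflEnvelope a n K x y Y = X → (X, Y) ∈ (Finset.Icc 1 (K + 1)).image
        (fun i => ((a : ℤ) + 1 - x i, (n : ℤ) - y i)) := fun he => by
      obtain ⟨i, hi1, hi2, e1, e2⟩ := h.eq_vertex ha' han' (X := a + 1 - X) (Y := n - Y)
        (by lia) (by lia) (by
          push_cast
          rw [← he, reflEnvelope]
          ring)
      exact Finset.mem_image.2 ⟨i, Finset.mem_Icc.2 ⟨hi1, hi2⟩, by rw [← e1, ← e2]; simp⟩
    rw [Finset.mem_coe, Finset.mem_union]
    obtain ⟨e1, e2⟩ := h.envelope_ends ha han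
    obtain ⟨e3, e4⟩ := h.reflEnvelope_ends ha han
    by_contra! hno
    have hl' := fun he => hno.1 (hl he)
    have hr' := fun he => hno.2 (hr he)
    refine hn ⟨⟨lt_of_le_of_ne h1 fun he => ?_, lt_of_le_of_ne h2 fun he => ?_⟩,
      lt_of_le_of_ne h3 hl', lt_of_le_of_ne h4 fun he => hr' he.symm⟩
    · rw [← he] at h3 h4 hl'
      exact hl' (by linarith)
    · rw [he] at h3 h4 hl'
      exact hl' (by linarith)
  · rintro ⟨⟨X, Y⟩, hp, rfl⟩
    refine ⟨?_, (X, Y), rfl⟩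
    rw [Finset.mem_coe, Finset.mem_union, Finset.mem_image, Finset.mem_image] at hp
    rcases hp with ⟨i, hi, he⟩ | ⟨i, hi, he⟩ <;>
    · rw [Finset.mem_Icc] at hi
      rw [Prod.mk.injEq] at he
      obtain ⟨rfl, rfl⟩ := he
      have hv := h.vertex_mem_interior ha han hco hi.1 hi.2
      have he := h.envelope_vertex ha' han' hi.2
      first
      | exact hint _ _ hv (.inl he)
      | refine hint _ _ (interior_Pan_refl (by lia) hv) (.inr ?_)
        push_cast
        rw [reflEnvelope_sub, he]

theorem card_boundary (h : IsSail a n (K + 1) x y) (ha : 1 < a) (han : a < n - 1)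
    (hco : Nat.Coprime a n) :
    ((Finset.Icc 1 (K + 1)).image (fun i => (x i, y i)) ∪
      (Finset.Icc 1 (K + 1)).image (fun i => ((a : ℤ) + 1 - x i, (n : ℤ) - y i))).card =
      2 * K := by
  have ha' : (0 : ℤ) < a := by lia
  have han' : (a : ℤ) < n := by lia
  have hinj : ∀ i ∈ Finset.Icc 1 (K + 1), ∀ j ∈ Finset.Icc 1 (K + 1), y i = y j → i = j := by
    intro i hi j hj he
    rw [Finset.mem_Icc] at hi hj
    rcases lt_trichotomy i j with hij | hij | hij
    · exact absurd he (h.snd_strictMono ha' han' hij hj.2).ne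
    · exact hij
    · exact absurd he (h.snd_strictMono ha' han' hij hi.2).ne'
  have hA : ((Finset.Icc 1 (K + 1)).image (fun i => (x i, y i))).card = K + 1 := by
    rw [Finset.card_image_of_injOn, Nat.card_Icc, Nat.add_sub_cancel]
    intro i hi j hj he
    exact hinj i hi j hj (Prod.ext_iff.1 he).2
  have hB : ((Finset.Icc 1 (K + 1)).image
      (fun i => ((a : ℤ) + 1 - x i, (n : ℤ) - y i))).card = K + 1 := by
    rw [Finset.card_image_of_injOn, Nat.card_Icc, Nat.add_sub_cancel]
    intro i hi j hj he
    have := (Prod.ext_iff.1 he).2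
    exact hinj i hi j hj (by simpa using this)
  obtain ⟨hx1, hy1⟩ := h.one_vertex ha' han'
  have hI : (Finset.Icc 1 (K + 1)).image (fun i => (x i, y i)) ∩
      (Finset.Icc 1 (K + 1)).image (fun i => ((a : ℤ) + 1 - x i, (n : ℤ) - y i)) =
      {(1, 1), ((a : ℤ), (n : ℤ) - 1)} := by
    ext ⟨X, Y⟩
    simp only [Finset.mem_inter, Finset.mem_image, Finset.mem_Icc, Finset.mem_insert,
      Finset.mem_singleton, Prod.mk.injEq]
    constructor
    · rintro ⟨⟨i, hi, rfl, rfl⟩, j, hj, e1, e2⟩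
      have hi' := h.envelope_vertex ha' han' hi.2
      have hj' := h.envelope_vertex ha' han' hj.2
      obtain ⟨b1, b2, b3, b4, b5⟩ := h.box i hi.2
      have hpos := h.snd_strictMono ha' han' hi.1 hi.2
      rw [h.y_zero] at hpos
      have hr : reflEnvelope a n K x y (y i) = x i := by
        rw [← e1, ← e2]
        push_cast
        rw [reflEnvelope_sub, hj']
      by_contra! hno
      have hlt := h.envelope_lt_reflEnvelope ha han hco (Y := y i) ?_ ?_
      · rw [hi', hr] at hlt
        exact lt_irrefl _ hlt
      · refine lt_of_le_of_ne (by lia) fun he => ?_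
        refine hno.1 ?_ he.symm
        rw [← hinj 1 (by simp) i (Finset.mem_Icc.2 hi) (by rw [hy1, he]), hx1]
      · refine lt_of_le_of_ne b4 fun he => ?_
        refine hno.2 ?_ he
        rw [hinj i (Finset.mem_Icc.2 hi) (K + 1) (by simp) (by rw [h.y_last, he]), h.x_last]
    · rintro (⟨rfl, rfl⟩ | ⟨rfl, rfl⟩)
      · exact ⟨⟨1, by lia, hx1, hy1⟩, K + 1, by lia, by rw [h.x_last]; ring,
          by rw [h.y_last]; ring⟩
      · exact ⟨⟨K + 1, by lia, h.x_last, h.y_last⟩, 1, by lia, by rw [hx1]; ring, by rw [hy1]⟩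
  have hI2 : ({(1, 1), ((a : ℤ), (n : ℤ) - 1)} : Finset (ℤ × ℤ)).card = 2 := by
    rw [Finset.card_pair]
    intro he
    have := (Prod.ext_iff.1 he).1
    simp only at this
    lia
  have := Finset.card_union_add_card_inter ((Finset.Icc 1 (K + 1)).image (fun i => (x i, y i)))
    ((Finset.Icc 1 (K + 1)).image (fun i => ((a : ℤ) + 1 - x i, (n : ℤ) - y i)))
  rw [hA, hB, hI, hI2] at this
  lia

end IsSail

/-- With `[q₀, …, q_m]` the continued fraction of `n/a`: the area of the interior hull of
`P_{a,n}` is `n - (q₀ + ⋯ + q_m)`; equivalently the sum of the partial quotients is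
`area(P_{a,n}) - area(P_{a,n}^{(1)})`; and if moreover `1 < a < n-1` then the boundary of
the interior hull contains exactly `2(q₀ + ⋯ + q_m) - 4` lattice points. -/
theorem stmt_18 (a n : ℕ) (ha : 0 < a) (han : a < n) (hco : Nat.Coprime a n)
    (m : ℕ) (q : ℕ → ℕ) (v : ℕ → ℤ × ℤ)
    (hv0 : v 0 = (1, 0)) (hv1 : v 1 = (0, 1))
    (hrec : ∀ i ≤ m, v (i + 2) = v i + (q i : ℤ) • v (i + 1))
    (hq : ∀ i ≤ m, 1 ≤ q i) (hqm : 1 ≤ m → 2 ≤ q m)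
    (hvm : v (m + 2) = ((a : ℤ), (n : ℤ))) :
    (MeasureTheory.volume (convexHull ℝ (interior (Pan a n) ∩ latt))).toReal =
      (n : ℝ) - ∑ i ∈ Finset.range (m + 1), (q i : ℝ) ∧
    (∑ i ∈ Finset.range (m + 1), (q i : ℝ)) =
      (MeasureTheory.volume (Pan a n)).toReal -
        (MeasureTheory.volume (convexHull ℝ (interior (Pan a n) ∩ latt))).toReal ∧
    (1 < a → a < n - 1 →
      ((frontier (convexHull ℝ (interior (Pan a n) ∩ latt)) ∩ latt).ncard : ℤ) =
        2 * ∑ i ∈ Finset.range (m + 1), (q i : ℤ) - 4) := by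
  obtain ⟨-, -, k, hk, hs, -⟩ := hasSail_of_continuant m q v hv0 hv1 hrec hq
  rw [hvm] at hs
  obtain ⟨x, y, h⟩ := hs
  obtain ⟨K, rfl⟩ : ∃ K, k = K + 1 := by
    rcases k with _ | K
    · have := h.y_zero
      have := h.y_last
      simp only at *
      lia
    · exact ⟨K, rfl⟩
  simp only at h
  have hvol := h.volume_hull ha han hco
  have hsum : ∑ i ∈ Finset.range (m + 1), (q i : ℝ) = K + 2 := by
    rw [← Nat.cast_sum, hk]
    push_cast
    ring
  refine ⟨by rw [hvol, hsum], by rw [hvol, hsum, volume_Pan (by lia)]; ring, fun ha1 han1 => ?_⟩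
  rw [h.frontier_hull_inter_latt ha han hco, Set.ncard_image_of_injective, Set.ncard_coe_finset,
    h.card_boundary ha1 han1 hco, ← Nat.cast_sum, hk]
  · push_cast
    ring
  · intro z w he
    simpa [Prod.ext_iff] using he
end
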